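/- arXiv:1703.08108 — 2 statements merged into one kernel-verified Lean document; each statement's English description precedes it below -/
import Mathlib

section
/- Two C¹ immersions f₀, f₁ : S¹ → ℝ² are regularly homotopic if and only if their Gauss maps G₀, G₁ : S¹ → S¹ have the same degree, where Gᵢ(x) = dfᵢ(x)(∂_θ)/‖dfᵢ(x)(∂_θ)‖ and ∂_θ is the unit tangent vector field of S¹ = ℝ/2πℤ. -/
open Real Function

noncomputable section

/-- A `C¹` immersion of the circle `S¹ = ℝ/2πℤ` into the plane, represented by a
`2π`-periodic `C¹` map `γ : ℝ → ℝ²` with nowhere-vanishing derivative. -/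
def IsCircleImmersion (γ : ℝ → ℝ × ℝ) : Prop :=
  ContDiff ℝ 1 γ ∧ (∀ t, γ (t + 2 * π) = γ t) ∧ ∀ t, deriv γ t ≠ 0

/-- The Gauss map `G(x) = dγ(x)(∂_θ)/‖dγ(x)(∂_θ)‖ : S¹ → S¹` of the immersion `γ` has
degree `d`.  This is expressed by a continuous angle lift `θ` of the Gauss map
(`G t = (cos θ t, sin θ t)`, i.e. `deriv γ t` is a positive multiple of
`(cos θ t, sin θ t)`) whose total variation over one period is `2πd`. -/
def GaussMapHasDegree (γ : ℝ → ℝ × ℝ) (d : ℤ) : Prop :=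
  ∃ θ : ℝ → ℝ, Continuous θ ∧
    (∀ t, ∃ r : ℝ, 0 < r ∧ deriv γ t = r • (cos (θ t), sin (θ t))) ∧
    θ (2 * π) - θ 0 = d * (2 * π)

/-- Two circle immersions are regularly homotopic: they are joined by a family of
immersions `Γ s`, `s ∈ [0,1]`, such that both the values and the derivatives depend
continuously on `(s, t)`. -/
def RegularlyHomotopic (γ₀ γ₁ : ℝ → ℝ × ℝ) : Prop :=
  ∃ Γ : ℝ → ℝ → ℝ × ℝ,
    (∀ s ∈ Set.Icc (0 : ℝ) 1, IsCircleImmersion (Γ s)) ∧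
    Γ 0 = γ₀ ∧ Γ 1 = γ₁ ∧
    Continuous (fun q : ℝ × ℝ => (Γ q.1 q.2, deriv (Γ q.1) q.2))

open Set Filter Topology

lemma eq_of_forall_cos_eq_one {S : Set ℝ} (hS : IsPreconnected S) {f : ℝ → ℝ}
    (hf : ContinuousOn f S) (h : ∀ t ∈ S, cos (f t) = 1) {x y : ℝ} (hx : x ∈ S) (hy : y ∈ S) :
    f x = f y := by
  have hd : IsDiscrete ((AddSubgroup.zmultiples (2 * π) : AddSubgroup ℝ) : Set ℝ) :=
    ⟨inferInstanceAs (DiscreteTopology (AddSubgroup.zmultiples (2 * π)))⟩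
  refine hS.constant_of_mapsTo hd hf (fun t ht => ?_) hx hy
  obtain ⟨n, hn⟩ := (cos_eq_one_iff _).1 (h t ht)
  exact AddSubgroup.mem_zmultiples_iff.2 ⟨n, by simpa using hn⟩

/-- The unit vector of the plane with angle `θ`. -/
def unitVector (θ : ℝ) : ℝ × ℝ := (cos θ, sin θ)

lemma continuous_unitVector : Continuous unitVector :=
  continuous_cos.prodMk continuous_sin

lemma unitVector_add_int_mul (θ : ℝ) (n : ℤ) : unitVector (θ + n * (2 * π)) = unitVector θ := by
  simp [unitVector]

lemma cos_sub_eq_one_of_smul_unitVector_eq {a b α β : ℝ} (ha : 0 < a) (hb : 0 < b)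
    (h : a • unitVector α = b • unitVector β) : cos (α - β) = 1 := by
  simp only [unitVector, Prod.smul_mk, smul_eq_mul, Prod.mk.injEq] at h
  obtain ⟨h1, h2⟩ := h
  have hα := sin_sq_add_cos_sq α
  have hβ := sin_sq_add_cos_sq β
  have hab : a = b := by
    have : a ^ 2 = b ^ 2 := by
      linear_combination (a * cos α + b * cos β) * h1 + (a * sin α + b * sin β) * h2
        - a ^ 2 * hα + b ^ 2 * hβ
    nlinarith
  subst hab
  rw [cos_sub, mul_left_cancel₀ ha.ne' h1, mul_left_cancel₀ ha.ne' h2]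
  linarith

lemma IsCircleImmersion.deriv_add_two_pi {γ : ℝ → ℝ × ℝ} (h : IsCircleImmersion γ) (t : ℝ) :
    deriv γ (t + 2 * π) = deriv γ t := by
  rw [← deriv_comp_add_const, funext h.2.1]

/-- A lift of the Gauss map of a circle immersion turns by the degree over every period. -/
lemma exists_polar_of_gaussMapHasDegree {γ : ℝ → ℝ × ℝ} {d : ℤ} (h : IsCircleImmersion γ)
    (hd : GaussMapHasDegree γ d) :
    ∃ r θ : ℝ → ℝ, Continuous r ∧ Continuous θ ∧ (∀ t, 0 < r t) ∧
      (∀ t, deriv γ t = r t • unitVector (θ t)) ∧ (∀ t, r (t + 2 * π) = r t) ∧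
      ∀ t, θ (t + 2 * π) = θ t + d * (2 * π) := by
  obtain ⟨θ, hθ, hr, hd⟩ := hd
  choose r hr0 hr using hr
  have hr' : ∀ t, deriv γ t = r t • unitVector (θ t) := hr
  have hγ : Continuous (deriv γ) := h.1.continuous_deriv le_rfl
  have hrr : r = fun t => cos (θ t) * (deriv γ t).1 + sin (θ t) * (deriv γ t).2 := by
    funext t
    rw [hr t]
    simp only [Prod.smul_mk, smul_eq_mul]
    linear_combination -r t * sin_sq_add_cos_sq (θ t)
  have hθ2 : ∀ t, θ (t + 2 * π) = θ t + d * (2 * π) := by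
    intro t
    have := eq_of_forall_cos_eq_one (S := univ) isPreconnected_univ
      (f := fun t => θ (t + 2 * π) - θ t) (by fun_prop)
      (fun t _ => cos_sub_eq_one_of_smul_unitVector_eq (hr0 (t + 2 * π)) (hr0 t)
        (by rw [← hr', ← hr', h.deriv_add_two_pi])) (mem_univ t) (mem_univ 0)
    simp only [zero_add] at this
    linarith
  refine ⟨r, θ, by rw [hrr]; fun_prop, hθ, hr0, hr', fun t => ?_, hθ2⟩
  rw [hrr]
  simp [h.deriv_add_two_pi, hθ2]

lemma GaussMapHasDegree.unique {γ : ℝ → ℝ × ℝ} {d d' : ℤ} (hd : GaussMapHasDegree γ d)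
    (hd' : GaussMapHasDegree γ d') : d = d' := by
  obtain ⟨θ, hθ, hr, hd⟩ := hd
  obtain ⟨θ', hθ', hr', hd'⟩ := hd'
  have := eq_of_forall_cos_eq_one (S := univ) isPreconnected_univ (f := fun t => θ t - θ' t)
    (by fun_prop) (fun t _ => by
      obtain ⟨r, hr0, hr⟩ := hr t
      obtain ⟨r', hr0', hr'⟩ := hr' t
      exact cos_sub_eq_one_of_smul_unitVector_eq hr0 hr0' (hr.symm.trans hr'))
    (mem_univ (2 * π)) (mem_univ 0)
  have h2 : (d : ℝ) * (2 * π) = d' * (2 * π) := by linarith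
  exact_mod_cast mul_right_cancel₀ two_pi_pos.ne' h2

/-- The Euclidean inner product of the plane. -/
def dot (v w : ℝ × ℝ) : ℝ := v.1 * w.1 + v.2 * w.2

lemma dot_comm (v w : ℝ × ℝ) : dot v w = dot w v := by
  simp only [dot]; ring

lemma dot_self_pos {v : ℝ × ℝ} (hv : v ≠ 0) : 0 < dot v v := by
  by_contra! h
  simp only [dot] at h
  exact hv (Prod.ext (by simpa using (by nlinarith : v.1 * v.1 = 0))
    (by simpa using (by nlinarith : v.2 * v.2 = 0)))

/-- Immersions whose velocities never make an obtuse or right angle have the same degree. -/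
lemma GaussMapHasDegree.of_dot_pos {γ δ : ℝ → ℝ × ℝ} {d : ℤ} (hγ : IsCircleImmersion γ)
    (hδ : IsCircleImmersion δ) (hpos : ∀ t, 0 < dot (deriv γ t) (deriv δ t))
    (hd : GaussMapHasDegree γ d) : GaussMapHasDegree δ d := by
  obtain ⟨θ, hθ, hr, hd⟩ := hd
  have cγ : Continuous (deriv γ) := hγ.1.continuous_deriv le_rfl
  have cδ : Continuous (deriv δ) := hδ.1.continuous_deriv le_rfl
  let q : ℝ → ℝ := fun t =>
    ((deriv γ t).1 * (deriv δ t).2 - (deriv γ t).2 * (deriv δ t).1) / dot (deriv γ t) (deriv δ t)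
  have hq : Continuous q := by
    refine Continuous.div (by fun_prop) ?_ fun t => (hpos t).ne'
    unfold dot
    fun_prop
  refine ⟨fun t => θ t + arctan (q t), hθ.add (continuous_arctan.comp hq), fun t => ?_, ?_⟩
  · obtain ⟨r, hr0, hr⟩ := hr t
    have hc := cos_arctan_pos (q t)
    have hp := hpos t
    refine ⟨dot (deriv γ t) (deriv δ t) / (r * cos (arctan (q t))), by positivity, ?_⟩
    have hs : sin (arctan (q t)) = q t * cos (arctan (q t)) := by
      conv_rhs => rw [← tan_arctan (q t), arctan_tan (neg_pi_div_two_lt_arctan _)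
        (arctan_lt_pi_div_two _), tan_mul_cos hc.ne']
    have hq' : q t * dot (deriv γ t) (deriv δ t) =
        (deriv γ t).1 * (deriv δ t).2 - (deriv γ t).2 * (deriv δ t).1 :=
      div_mul_cancel₀ _ hp.ne'
    rw [cos_add, sin_add, hs]
    generalize cos (arctan (q t)) = c at *
    generalize q t = p at *
    generalize deriv δ t = v at *
    have h1 := sin_sq_add_cos_sq (θ t)
    rw [hr] at hq' ⊢
    simp only [dot, Prod.smul_mk, smul_eq_mul] at hq' ⊢
    replace hq' : p * (cos (θ t) * v.1 + sin (θ t) * v.2) =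
        cos (θ t) * v.2 - sin (θ t) * v.1 :=
      mul_left_cancel₀ hr0.ne' (by linear_combination hq')
    ext
    · simp only
      field_simp
      linear_combination -v.1 * h1 + sin (θ t) * hq'
    · simp only
      field_simp
      linear_combination -v.2 * h1 - cos (θ t) * hq'
  · have hq0 : q (2 * π) = q 0 := by
      have h1 := hγ.deriv_add_two_pi 0
      have h2 := hδ.deriv_add_two_pi 0
      rw [zero_add] at h1 h2
      simp only [q, h1, h2]
    simp only [hq0]
    linarith

lemma RegularlyHomotopic.gaussMapHasDegree {γ₀ γ₁ : ℝ → ℝ × ℝ} {d : ℤ}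
    (h : RegularlyHomotopic γ₀ γ₁) (hd : GaussMapHasDegree γ₀ d) : GaussMapHasDegree γ₁ d := by
  obtain ⟨Γ, hΓ, rfl, rfl, hc⟩ := h
  have hV : Continuous fun q : ℝ × ℝ => deriv (Γ q.1) q.2 := hc.snd
  refine (isPreconnected_Icc (a := (0 : ℝ)) (b := 1)).induction₂
    (fun s s' => GaussMapHasDegree (Γ s) d ↔ GaussMapHasDegree (Γ s') d) (fun s hs => ?_)
    (fun _ _ _ _ _ _ => Iff.trans) (fun _ _ _ _ => Iff.symm) (by simp) (by simp) |>.1 hd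
  have key : ∀ᶠ s' in 𝓝 s, ∀ t ∈ Icc 0 (2 * π), 0 < dot (deriv (Γ s) t) (deriv (Γ s') t) := by
    refine isCompact_Icc.eventually_forall_of_forall_eventually fun t _ => ?_
    have hcont : Continuous fun z : ℝ × ℝ => dot (deriv (Γ s) z.2) (deriv (Γ z.1) z.2) := by
      have : Continuous fun z : ℝ × ℝ => deriv (Γ s) z.2 :=
        hV.comp (continuous_const.prodMk continuous_snd)
      unfold dot
      fun_prop
    exact hcont.continuousAt.eventually (lt_mem_nhds (dot_self_pos ((hΓ s hs).2.2 t)))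
  filter_upwards [nhdsWithin_le_nhds key, self_mem_nhdsWithin] with s' hs' hmem
  have hper : Periodic (fun t => dot (deriv (Γ s) t) (deriv (Γ s') t)) (2 * π) := fun t => by
    simp only [(hΓ s hs).deriv_add_two_pi, (hΓ s' hmem).deriv_add_two_pi]
  have hpos : ∀ t, 0 < dot (deriv (Γ s) t) (deriv (Γ s') t) := fun t => by
    obtain ⟨y, hy, hty⟩ := hper.exists_mem_Ico₀ two_pi_pos t
    rw [hty]
    exact hs' y (Ico_subset_Icc_self hy)
  exact ⟨.of_dot_pos (hΓ s hs) (hΓ s' hmem) hpos, .of_dot_pos (hΓ s' hmem) (hΓ s hs) fun t => by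
    rw [dot_comm]; exact hpos t⟩

/-- If the weighted mean of a planar direction field over a period is a unit vector, then the
angle is constant over that period. -/
lemma eq_of_integral_smul_unitVector_eq {r θ : ℝ → ℝ} (hr : Continuous r) (hθ : Continuous θ)
    (hr0 : ∀ t, 0 < r t) {α : ℝ}
    (h : ∫ t in 0..2 * π, r t • unitVector (θ t) = (∫ t in 0..2 * π, r t) • unitVector α)
    {x y : ℝ} (hx : x ∈ Icc 0 (2 * π)) (hy : y ∈ Icc 0 (2 * π)) : θ x = θ y := by
  have hu : Continuous fun t => r t • unitVector (θ t) :=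
    hr.smul (continuous_unitVector.comp hθ)
  let L : ℝ × ℝ →L[ℝ] ℝ :=
    cos α • ContinuousLinearMap.fst ℝ ℝ ℝ + sin α • ContinuousLinearMap.snd ℝ ℝ ℝ
  have hL : ∀ β, L (unitVector β) = cos (β - α) := fun β => by
    simp [L, unitVector, cos_sub]; ring
  have hint : ∫ t in 0..2 * π, r t * (1 - cos (θ t - α)) = 0 := by
    have h1 : ∫ t in 0..2 * π, r t * cos (θ t - α) = ∫ t in 0..2 * π, r t := by
      have := L.intervalIntegral_comp_comm (μ := MeasureTheory.volume)
        (hu.intervalIntegrable 0 (2 * π))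
      rw [h, map_smul, hL, sub_self, cos_zero] at this
      simpa only [map_smul, hL, smul_eq_mul, mul_one] using this
    simp_rw [mul_sub, mul_one]
    rw [intervalIntegral.integral_sub (hr.intervalIntegrable _ _)
      (Continuous.intervalIntegrable (by fun_prop) _ _), h1, sub_self]
  have hcos : ∀ t ∈ Icc 0 (2 * π), cos (θ t - α) = 1 := by
    by_contra! hne
    obtain ⟨t, ht, hne⟩ := hne
    refine (intervalIntegral.integral_pos (f := fun t => r t * (1 - cos (θ t - α))) two_pi_pos
      (by fun_prop) (fun t _ => mul_nonneg (hr0 t).le (sub_nonneg.2 (cos_le_one _)))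
      ⟨t, ht, mul_pos (hr0 t) (sub_pos.2 (lt_of_le_of_ne (cos_le_one _) hne))⟩).ne' hint
  have := eq_of_forall_cos_eq_one isPreconnected_Icc (f := fun t => θ t - α)
    (by fun_prop) hcos hx hy
  simpa using this

/-- The velocity field with speed `r` and angle `θ`, corrected by a multiple of `r` so that its
integral over a period vanishes. -/
def closedVelocity (r θ : ℝ → ℝ) (t : ℝ) : ℝ × ℝ :=
  r t • unitVector (θ t) -
    r t • (∫ u in 0..2 * π, r u)⁻¹ • ∫ u in 0..2 * π, r u • unitVector (θ u)

lemma integral_speed_pos {r : ℝ → ℝ} (hr : Continuous r) (hr0 : ∀ t, 0 < r t) :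
    0 < ∫ t in 0..2 * π, r t :=
  intervalIntegral.intervalIntegral_pos_of_pos (hr.intervalIntegrable _ _) hr0 two_pi_pos

lemma integral_closedVelocity {r θ : ℝ → ℝ} (hr : Continuous r) (hθ : Continuous θ)
    (hr0 : ∀ t, 0 < r t) : ∫ t in 0..2 * π, closedVelocity r θ t = 0 := by
  unfold closedVelocity
  rw [intervalIntegral.integral_sub, intervalIntegral.integral_smul_const,
    smul_inv_smul₀ (integral_speed_pos hr hr0).ne', sub_self]
  · exact (hr.smul (continuous_unitVector.comp hθ)).intervalIntegrable _ _
  · exact (hr.smul continuous_const).intervalIntegrable _ _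

lemma closedVelocity_ne_zero {r θ : ℝ → ℝ} (hr : Continuous r) (hθ : Continuous θ)
    (hr0 : ∀ t, 0 < r t)
    (hne : ∃ x ∈ Icc 0 (2 * π), ∃ y ∈ Icc 0 (2 * π), θ x ≠ θ y) (t : ℝ) :
    closedVelocity r θ t ≠ 0 := by
  intro h
  obtain ⟨x, hx, y, hy, hxy⟩ := hne
  refine hxy (eq_of_integral_smul_unitVector_eq hr hθ hr0 (α := θ t) ?_ hx hy)
  rw [closedVelocity, sub_eq_zero] at h
  rw [smul_right_injective _ (hr0 t).ne' h, smul_inv_smul₀ (integral_speed_pos hr hr0).ne']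

lemma closedVelocity_add_two_pi {r θ : ℝ → ℝ} {d : ℤ} (hr : ∀ t, r (t + 2 * π) = r t)
    (hθ : ∀ t, θ (t + 2 * π) = θ t + d * (2 * π)) (t : ℝ) :
    closedVelocity r θ (t + 2 * π) = closedVelocity r θ t := by
  simp only [closedVelocity, hr, hθ, unitVector_add_int_mul]

lemma continuous_closedVelocity {X : Type*} [TopologicalSpace X] {r θ : X → ℝ → ℝ}
    (hr : Continuous (uncurry r)) (hθ : Continuous (uncurry θ)) (hr0 : ∀ s t, 0 < r s t) :
    Continuous (uncurry fun s t => closedVelocity (r s) (θ s) t) := by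
  have hu : Continuous (uncurry fun s t => r s t • unitVector (θ s t)) :=
    hr.smul (continuous_unitVector.comp hθ)
  have hrs : ∀ s, Continuous (r s) := fun s => hr.comp (by fun_prop : Continuous fun t => (s, t))
  have hR : Continuous fun s => ∫ u in 0..2 * π, r s u :=
    intervalIntegral.continuous_parametric_intervalIntegral_of_continuous hr continuous_const
  have hK : Continuous fun s => ∫ u in 0..2 * π, r s u • unitVector (θ s u) :=
    intervalIntegral.continuous_parametric_intervalIntegral_of_continuous hu continuous_const
  have hKR : Continuous fun s => (∫ u in 0..2 * π, r s u)⁻¹ •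
      ∫ u in 0..2 * π, r s u • unitVector (θ s u) :=
    (hR.inv₀ fun s => (integral_speed_pos (hrs s) (hr0 s)).ne').smul hK
  exact hu.sub (hr.smul (hKR.comp continuous_fst))

/-- A continuous family of periodic, nowhere vanishing velocity fields of zero mean integrates
to a regular homotopy. -/
lemma regularlyHomotopic_of_velocity {γ₀ γ₁ : ℝ → ℝ × ℝ} (h₀ : IsCircleImmersion γ₀)
    (h₁ : IsCircleImmersion γ₁) {w : ℝ → ℝ → ℝ × ℝ} (hw : Continuous (uncurry w))
    (hne : ∀ s t, w s t ≠ 0) (hper : ∀ s t, w s (t + 2 * π) = w s t)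
    (hint : ∀ s, ∫ t in 0..2 * π, w s t = 0) (hw0 : w 0 = deriv γ₀) (hw1 : w 1 = deriv γ₁) :
    RegularlyHomotopic γ₀ γ₁ := by
  have hws : ∀ s, Continuous (w s) := fun s => hw.comp (by fun_prop : Continuous fun t => (s, t))
  have hprim : ∀ γ, IsCircleImmersion γ → ∀ t, γ 0 + ∫ u in 0..t, deriv γ u = γ t := by
    intro γ h t
    rw [intervalIntegral.integral_deriv_eq_sub
      (fun x _ => (h.1.differentiable one_ne_zero).differentiableAt)
      ((h.1.continuous_deriv le_rfl).intervalIntegrable _ _)]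
    abel
  let Γ : ℝ → ℝ → ℝ × ℝ := fun s t => ((1 - s) • γ₀ 0 + s • γ₁ 0) + ∫ u in 0..t, w s u
  have hder : ∀ s t, HasDerivAt (Γ s) (w s t) t := fun s t =>
    ((hws s).integral_hasStrictDerivAt 0 t).hasDerivAt.const_add _
  have hderiv : ∀ s, deriv (Γ s) = w s := fun s => funext fun t => (hder s t).deriv
  refine ⟨Γ, fun s _ => ⟨?_, fun t => ?_, fun t => ?_⟩, ?_, ?_, ?_⟩
  · exact contDiff_one_iff_deriv.2 ⟨fun t => (hder s t).differentiableAt, hderiv s ▸ hws s⟩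
  · have hadd := intervalIntegral.integral_add_adjacent_intervals (μ := MeasureTheory.volume)
      ((hws s).intervalIntegrable 0 t) ((hws s).intervalIntegrable t (t + 2 * π))
    have hshift := Function.Periodic.intervalIntegral_add_eq (f := w s) (hper s) t 0
    rw [zero_add, hint s] at hshift
    simp only [Γ, ← hadd, hshift, add_zero]
  · rw [hderiv]
    exact hne s t
  · funext t
    simp [Γ, hw0, hprim γ₀ h₀]
  · funext t
    simp [Γ, hw1, hprim γ₁ h₁]
  · simp only [hderiv]
    refine Continuous.prodMk (Continuous.add (by fun_prop) ?_) hw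
    exact intervalIntegral.continuous_parametric_intervalIntegral_of_continuous
      (f := fun (q : ℝ × ℝ) u => w q.1 u) (s := Prod.snd)
      (hw.comp (by fun_prop : Continuous fun p : (ℝ × ℝ) × ℝ => (p.1.1, p.2))) continuous_snd

lemma IsCircleImmersion.integral_deriv {γ : ℝ → ℝ × ℝ} (h : IsCircleImmersion γ) :
    ∫ t in 0..2 * π, deriv γ t = 0 := by
  rw [intervalIntegral.integral_deriv_eq_sub
    (fun x _ => (h.1.differentiable one_ne_zero).differentiableAt)
    ((h.1.continuous_deriv le_rfl).intervalIntegrable _ _), ← h.2.1 0, zero_add, sub_self]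

lemma IsCircleImmersion.closedVelocity_eq_deriv {γ : ℝ → ℝ × ℝ} (h : IsCircleImmersion γ)
    {r θ : ℝ → ℝ} (hγ : ∀ t, deriv γ t = r t • unitVector (θ t)) :
    closedVelocity r θ = deriv γ := by
  funext t
  simp only [closedVelocity, ← hγ, h.integral_deriv, smul_zero, sub_zero]

lemma exists_angle_ne {γ : ℝ → ℝ × ℝ} (h : IsCircleImmersion γ) {r θ : ℝ → ℝ}
    (hr : Continuous r) (hr0 : ∀ t, 0 < r t) (hγ : ∀ t, deriv γ t = r t • unitVector (θ t)) :
    ∃ x ∈ Icc 0 (2 * π), ∃ y ∈ Icc 0 (2 * π), θ x ≠ θ y := by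
  by_contra! hc
  have h0 : (0 : ℝ) ∈ Icc 0 (2 * π) := ⟨le_rfl, two_pi_pos.le⟩
  have hcongr : ∫ t in 0..2 * π, deriv γ t = ∫ t in 0..2 * π, r t • unitVector (θ 0) := by
    refine intervalIntegral.integral_congr fun t ht => ?_
    rw [uIcc_of_le two_pi_pos.le] at ht
    simp only [hγ, hc t ht 0 h0]
  rw [h.integral_deriv, intervalIntegral.integral_smul_const] at hcongr
  have hu : unitVector (θ 0) = 0 :=
    (smul_eq_zero.1 hcongr.symm).resolve_left (integral_speed_pos hr hr0).ne'
  simp only [unitVector, Prod.mk_eq_zero] at hu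
  have := sin_sq_add_cos_sq (θ 0)
  simp [hu.1, hu.2] at this

/-- Every function on `[0, 2π]` fails to have one of `cos`, `sin` as an affine image. -/
lemma exists_periodic_not_affine_image (f : ℝ → ℝ) :
    ∃ η : ℝ → ℝ, Continuous η ∧ (∀ t, η (t + 2 * π) = η t) ∧
      ¬ ∃ a b : ℝ, ∀ t ∈ Icc 0 (2 * π), η t = a * f t + b := by
  by_contra! hc
  obtain ⟨a, b, hab⟩ := hc cos continuous_cos cos_add_two_pi
  obtain ⟨a', b', hab'⟩ := hc sin continuous_sin sin_add_two_pi
  have hπ := pi_pos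
  have m0 : (0 : ℝ) ∈ Icc 0 (2 * π) := ⟨le_rfl, by linarith⟩
  have m1 : π / 2 ∈ Icc 0 (2 * π) := ⟨by linarith, by linarith⟩
  have m2 : π ∈ Icc 0 (2 * π) := ⟨by linarith, by linarith⟩
  have c0 := hab 0 m0
  have c2 := hab π m2
  have s0 := hab' 0 m0
  have s1 := hab' (π / 2) m1
  have s2 := hab' π m2
  simp only [cos_zero, cos_pi, sin_zero, sin_pi, sin_pi_div_two] at *
  have ha' : a' * (f 0 - f π) = 0 := by linarith
  rcases mul_eq_zero.1 ha' with h | h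
  · subst h
    linarith
  · have : a * (f 0 - f π) = 2 := by linarith
    rw [h] at this
    norm_num at this

/-- Nonconstant functions `f`, `g` can be joined by a quadratic path of nonconstant functions. -/
lemma exists_periodic_correction {f g : ℝ → ℝ}
    (hf : ∃ x ∈ Icc 0 (2 * π), ∃ y ∈ Icc 0 (2 * π), f x ≠ f y)
    (hg : ∃ x ∈ Icc 0 (2 * π), ∃ y ∈ Icc 0 (2 * π), g x ≠ g y) :
    ∃ η : ℝ → ℝ, Continuous η ∧ (∀ t, η (t + 2 * π) = η t) ∧ ∀ s ∈ Icc (0 : ℝ) 1,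
      ∃ x ∈ Icc 0 (2 * π), ∃ y ∈ Icc 0 (2 * π),
        (1 - s) * f x + s * g x + s * (1 - s) * η x ≠
          (1 - s) * f y + s * g y + s * (1 - s) * η y := by
  by_cases hlin : ∀ s ∈ Icc (0 : ℝ) 1, ∃ x ∈ Icc 0 (2 * π), ∃ y ∈ Icc 0 (2 * π),
      (1 - s) * f x + s * g x ≠ (1 - s) * f y + s * g y
  · exact ⟨0, continuous_const, fun _ => rfl, by simpa using hlin⟩
  push Not at hlin
  obtain ⟨p, -, hp⟩ := hlin
  have hp0 : p ≠ 0 := by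
    rintro rfl
    obtain ⟨x, hx, y, hy, hxy⟩ := hf
    exact hxy (by simpa using hp x hx y hy)
  have m0 : (0 : ℝ) ∈ Icc 0 (2 * π) := ⟨le_rfl, two_pi_pos.le⟩
  obtain ⟨η, cη, perη, hη⟩ := exists_periodic_not_affine_image f
  refine ⟨η, cη, perη, fun s hs => ?_⟩
  by_contra! hc
  rcases eq_or_ne s 0 with rfl | hs0
  · obtain ⟨x, hx, y, hy, hxy⟩ := hf
    exact hxy (by simpa using hc x hx y hy)
  rcases eq_or_ne s 1 with rfl | hs1
  · obtain ⟨x, hx, y, hy, hxy⟩ := hg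
    exact hxy (by simpa using hc x hx y hy)
  have hs1' : 1 - s ≠ 0 := sub_ne_zero.2 hs1.symm
  -- `g` is affine in `f` with slope `-(1 - p) / p`, hence so is `η`.
  let a := (s * (1 - p) / p - (1 - s)) / (s * (1 - s))
  refine hη ⟨a, η 0 - a * f 0, fun t ht => ?_⟩
  have e1 := hp t ht 0 m0
  have e2 := hc t ht 0 m0
  simp only [a]
  field_simp
  linear_combination p * e2 - s * e1

lemma regularlyHomotopic_of_gaussMapHasDegree {γ₀ γ₁ : ℝ → ℝ × ℝ} {d : ℤ}
    (h₀ : IsCircleImmersion γ₀) (h₁ : IsCircleImmersion γ₁)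
    (hd₀ : GaussMapHasDegree γ₀ d) (hd₁ : GaussMapHasDegree γ₁ d) :
    RegularlyHomotopic γ₀ γ₁ := by
  obtain ⟨r₀, θ₀, cr₀, cθ₀, pos₀, hγ₀, per₀, turn₀⟩ := exists_polar_of_gaussMapHasDegree h₀ hd₀
  obtain ⟨r₁, θ₁, cr₁, cθ₁, pos₁, hγ₁, per₁, turn₁⟩ := exists_polar_of_gaussMapHasDegree h₁ hd₁
  obtain ⟨η, cη, perη, hη⟩ := exists_periodic_correction
    (exists_angle_ne h₀ cr₀ pos₀ hγ₀) (exists_angle_ne h₁ cr₁ pos₁ hγ₁)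
  obtain ⟨σ, cσ, hσ, σ0, σ1⟩ : ∃ σ : ℝ → ℝ, Continuous σ ∧ (∀ s, σ s ∈ Icc (0 : ℝ) 1) ∧
      σ 0 = 0 ∧ σ 1 = 1 :=
    ⟨fun s => projIcc 0 1 zero_le_one s,
      continuous_subtype_val.comp (continuous_projIcc (h := zero_le_one)),
      fun s => (projIcc 0 1 zero_le_one s).2, by simp, by simp⟩
  let r : ℝ → ℝ → ℝ := fun s t => (1 - σ s) * r₀ t + σ s * r₁ t
  let θ : ℝ → ℝ → ℝ := fun s t =>
    (1 - σ s) * θ₀ t + σ s * θ₁ t + σ s * (1 - σ s) * η t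
  have cr : Continuous (uncurry r) := by simp only [uncurry_def, r]; fun_prop
  have cθ : Continuous (uncurry θ) := by simp only [uncurry_def, θ]; fun_prop
  have crs : ∀ s, Continuous (r s) := fun s => by simp only [r]; fun_prop
  have cθs : ∀ s, Continuous (θ s) := fun s => by simp only [θ]; fun_prop
  have pos : ∀ s t, 0 < r s t := fun s t => by
    obtain ⟨hs0, hs1⟩ := hσ s
    rcases hs0.eq_or_lt with h | h
    · simp [r, ← h, pos₀]
    · exact add_pos_of_nonneg_of_pos (mul_nonneg (sub_nonneg.2 hs1) (pos₀ t).le)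
        (mul_pos h (pos₁ t))
  refine regularlyHomotopic_of_velocity h₀ h₁ (w := fun s => closedVelocity (r s) (θ s))
    (continuous_closedVelocity cr cθ pos)
    (fun s => closedVelocity_ne_zero (crs s) (cθs s) (pos s) (hη (σ s) (hσ s)))
    (fun s => closedVelocity_add_two_pi (d := d) (fun t => ?_) fun t => ?_)
    (fun s => integral_closedVelocity (crs s) (cθs s) (pos s)) ?_ ?_
  · simp only [r, per₀, per₁]
  · simp only [θ, turn₀, turn₁, perη]
    ring
  · have e1 : r 0 = r₀ := by funext t; simp [r, σ0]
    have e2 : θ 0 = θ₀ := by funext t; simp [θ, σ0]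
    simp only [e1, e2]
    exact h₀.closedVelocity_eq_deriv hγ₀
  · have e1 : r 1 = r₁ := by funext t; simp [r, σ1]
    have e2 : θ 1 = θ₁ := by funext t; simp [θ, σ1]
    simp only [e1, e2]
    exact h₁.closedVelocity_eq_deriv hγ₁

/-- **Whitney–Graustein theorem**: two `C¹` immersions `S¹ → ℝ²` are regularly homotopic
if and only if their Gauss maps have the same degree. -/
theorem whitney_graustein (γ₀ γ₁ : ℝ → ℝ × ℝ) (d₀ d₁ : ℤ)
    (h₀ : IsCircleImmersion γ₀) (h₁ : IsCircleImmersion γ₁)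
    (hd₀ : GaussMapHasDegree γ₀ d₀) (hd₁ : GaussMapHasDegree γ₁ d₁) :
    RegularlyHomotopic γ₀ γ₁ ↔ d₀ = d₁ := by
  refine ⟨fun h => (h.gaussMapHasDegree hd₀).unique hd₁, ?_⟩
  rintro rfl
  exact regularlyHomotopic_of_gaussMapHasDegree h₀ h₁ hd₀ hd₁

end
end

section
/- Let f₀ : S² ↪ ℝ³ be the standard embedding, E the equator of S², p ∈ E a base point, and H_S, H_N the closed southern and northern hemispheres. Then the restriction map Imm_p(S², ℝ³) → Imm_p(H_S, ℝ³), f ↦ f|_{H_S}, is a Serre fibration, and its fibre over f₀|_{H_S} is homeomorphic to Imm_E(H_N, ℝ³). -/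
open Metric Function Bundle
open scoped Manifold

noncomputable section

abbrev E3 := EuclideanSpace ℝ (Fin 3)
abbrev S2 := Metric.sphere (0 : E3) 1

instance : Fact (Module.finrank ℝ E3 = 2 + 1) := ⟨by simp⟩

abbrev TB := TangentBundle (𝓡 2) S2
abbrev TB' := TangentBundle 𝓘(ℝ, E3) E3

/-- The tangent map (1-jet) of a map `S² → ℝ³`. -/
def tm (f : S2 → E3) : TB → TB' := tangentMap (𝓡 2) 𝓘(ℝ, E3) f

/-- The standard embedding `f₀ : S² ↪ ℝ³`. -/
def stdEmb : S2 → E3 := fun x => (x : E3)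

/-- The closed southern hemisphere `H_S`. -/
def HS : Set S2 := {x : S2 | (x : E3) 2 ≤ 0}

/-- The closed northern hemisphere `H_N`. -/
def HN : Set S2 := {x : S2 | 0 ≤ (x : E3) 2}

/-- The equator `E = H_N ∩ H_S`. -/
def EqS : Set S2 := {x : S2 | (x : E3) 2 = 0}

/-- The space of `C¹` immersions of (a neighbourhood of) the closed set `A ⊆ S²` into
`ℝ³` whose 1-jet agrees with that of the standard embedding `f₀` at every point of `B`.
An immersion is recorded by its tangent map (1-jet) `G` over `A`, which determines both
the map and its differential; the topology — the `C¹` topology — is the compact-open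
topology on these tangent maps.  (For `A = S²` this is the space of immersions of `S²`;
for `B = {p}` the pointed immersions `Imm_p`; for `B = E` the space `Imm_E`.) -/
abbrev ImmGerm (A B : Set S2) : Type :=
  {G : C({v : TB // v.proj ∈ A}, TB') //
    ∃ (f : S2 → E3) (U : Set S2), IsOpen U ∧ A ⊆ U ∧
      ContMDiffOn (𝓡 2) 𝓘(ℝ, E3) 1 f U ∧
      (∀ x ∈ A, Injective (mfderiv (𝓡 2) 𝓘(ℝ, E3) f x)) ∧
      (∀ v : {v : TB // v.proj ∈ A}, G v = tm f v.1) ∧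
      (∀ v : TB, v.proj ∈ B → tm f v = tm stdEmb v)}

/-- A map is a Serre fibration if it has the homotopy lifting property with respect to
all cubes (equivalently, all discs `Dⁿ`). -/
def IsSerreFibration {X Y : Type*} [TopologicalSpace X] [TopologicalSpace Y]
    (pr : X → Y) : Prop :=
  ∀ (n : ℕ) (H : (Fin n → unitInterval) × unitInterval → Y)
    (g : (Fin n → unitInterval) → X), Continuous H → Continuous g →
    (∀ c, pr (g c) = H (c, 0)) →
    ∃ L : (Fin n → unitInterval) × unitInterval → X, Continuous L ∧
      (∀ c, L (c, 0) = g c) ∧ ∀ z, pr (L z) = H z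

section C1Families

variable {P Q V W Z : Type*} [TopologicalSpace P] [TopologicalSpace Q]
  [NormedAddCommGroup V] [NormedSpace ℝ V] [NormedAddCommGroup W] [NormedSpace ℝ W]
  [NormedAddCommGroup Z] [NormedSpace ℝ Z]

/-- A continuous family, indexed by `P`, of maps which are `C¹` on `K \ {0}`, with derivatives
`φ'` relative to `K`. -/
def C1On (K : Set E3) (φ : P → E3 → V) (φ' : P → E3 → E3 →L[ℝ] V) : Prop :=
  ∀ q x, x ∈ K → x ≠ 0 → HasFDerivWithinAt (φ q) (φ' q x) K x ∧
    ContinuousWithinAt (fun z : P × E3 => φ z.1 z.2) (Set.univ ×ˢ K) (q, x) ∧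
    ContinuousWithinAt (fun z : P × E3 => φ' z.1 z.2) (Set.univ ×ˢ K) (q, x)

namespace C1On

variable {K L : Set E3} {φ : P → E3 → V} {φ' : P → E3 → E3 →L[ℝ] V}
  {ψ : P → E3 → V} {ψ' : P → E3 → E3 →L[ℝ] V}

lemma hasFDerivAt (h : C1On Set.univ φ φ') (q : P) {x : E3} (hx : x ≠ 0) :
    HasFDerivAt (φ q) (φ' q x) x :=
  hasFDerivWithinAt_univ.1 (h q x trivial hx).1

lemma continuousAt (h : C1On Set.univ φ φ') (q : P) {x : E3} (hx : x ≠ 0) :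
    ContinuousAt (fun z : P × E3 => φ z.1 z.2) (q, x) := by
  simpa [continuousWithinAt_univ] using (h q x trivial hx).2.1

lemma continuousAt_deriv (h : C1On Set.univ φ φ') (q : P) {x : E3} (hx : x ≠ 0) :
    ContinuousAt (fun z : P × E3 => φ' z.1 z.2) (q, x) := by
  simpa [continuousWithinAt_univ] using (h q x trivial hx).2.2

lemma continuous_comp {X : Type*} [TopologicalSpace X] (h : C1On Set.univ φ φ') {a : X → P}
    {b : X → E3} (ha : Continuous a) (hb : Continuous b) (hb0 : ∀ x, b x ≠ 0) :
    Continuous (fun x => φ (a x) (b x)) :=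
  continuous_iff_continuousAt.2 fun x =>
    ContinuousAt.comp (f := fun x => (a x, b x)) (x := x)
      (g := fun z : P × E3 => φ z.1 z.2) (h.continuousAt (a x) (hb0 x))
      (ha.prodMk hb).continuousAt

lemma continuous_deriv_comp {X : Type*} [TopologicalSpace X] (h : C1On Set.univ φ φ') {a : X → P}
    {b : X → E3} (ha : Continuous a) (hb : Continuous b) (hb0 : ∀ x, b x ≠ 0) :
    Continuous (fun x => φ' (a x) (b x)) :=
  continuous_iff_continuousAt.2 fun x =>
    ContinuousAt.comp (f := fun x => (a x, b x)) (x := x)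
      (g := fun z : P × E3 => φ' z.1 z.2) (h.continuousAt_deriv (a x) (hb0 x))
      (ha.prodMk hb).continuousAt

lemma mono (h : C1On K φ φ') (hL : L ⊆ K) : C1On L φ φ' := fun q x hx h0 =>
  ⟨(h q x (hL hx) h0).1.mono hL,
    (h q x (hL hx) h0).2.1.mono (Set.prod_mono subset_rfl hL),
    (h q x (hL hx) h0).2.2.mono (Set.prod_mono subset_rfl hL)⟩

lemma add (h : C1On K φ φ') (k : C1On K ψ ψ') :
    C1On K (fun q x => φ q x + ψ q x) (fun q x => φ' q x + ψ' q x) := fun q x hx h0 =>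
  ⟨(h q x hx h0).1.add (k q x hx h0).1, (h q x hx h0).2.1.add (k q x hx h0).2.1,
    (h q x hx h0).2.2.add (k q x hx h0).2.2⟩

lemma sub (h : C1On K φ φ') (k : C1On K ψ ψ') :
    C1On K (fun q x => φ q x - ψ q x) (fun q x => φ' q x - ψ' q x) := fun q x hx h0 =>
  ⟨(h q x hx h0).1.sub (k q x hx h0).1, (h q x hx h0).2.1.sub (k q x hx h0).2.1,
    (h q x hx h0).2.2.sub (k q x hx h0).2.2⟩

lemma const_smul (h : C1On K φ φ') (c : ℝ) :
    C1On K (fun q x => c • φ q x) (fun q x => c • φ' q x) := fun q x hx h0 =>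
  ⟨(h q x hx h0).1.const_smul c, (h q x hx h0).2.1.const_smul c, (h q x hx h0).2.2.const_smul c⟩

lemma bilin (B : V →L[ℝ] W →L[ℝ] Z) {ξ : P → E3 → W} {ξ' : P → E3 → E3 →L[ℝ] W}
    (h : C1On K φ φ') (k : C1On K ξ ξ') :
    C1On K (fun q x => B (φ q x) (ξ q x))
      (fun q x => (B (φ q x)) ∘L ξ' q x + (B.flip (ξ q x)) ∘L φ' q x) := by
  intro q x hx h0
  obtain ⟨h1, h2, h3⟩ := h q x hx h0
  obtain ⟨k1, k2, k3⟩ := k q x hx h0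
  refine ⟨(B.hasFDerivWithinAt_of_bilinear h1 k1).congr_fderiv (by ext; simp), ?_, ?_⟩
  · exact (B.continuous.continuousAt.comp_continuousWithinAt h2).clm_apply k2
  · exact ((B.continuous.continuousAt.comp_continuousWithinAt h2).clm_comp k3).add
      ((B.flip.continuous.continuousAt.comp_continuousWithinAt k2).clm_comp h3)

lemma smul {c : P → E3 → ℝ} {c' : P → E3 → E3 →L[ℝ] ℝ} (k : C1On K c c') (h : C1On K φ φ') :
    C1On K (fun q x => c q x • φ q x)
      (fun q x => c q x • φ' q x + (c' q x).smulRight (φ q x)) := by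
  have := bilin (ContinuousLinearMap.lsmul ℝ ℝ) k h
  convert this using 3
  · rfl
  · ext v
    simp

lemma clm_comp (B : V →L[ℝ] W) (h : C1On K φ φ') :
    C1On K (fun q x => B (φ q x)) (fun q x => B ∘L φ' q x) := fun q x hx h0 =>
  ⟨B.hasFDerivAt.comp_hasFDerivWithinAt x (h q x hx h0).1,
    B.continuous.continuousAt.comp_continuousWithinAt (h q x hx h0).2.1,
    ((ContinuousLinearMap.compL ℝ E3 V W) B).continuous.continuousAt.comp_continuousWithinAt
      (h q x hx h0).2.2⟩

lemma reparam (h : C1On K φ φ') {r : Q → P} (hr : Continuous r) :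
    C1On K (fun q => φ (r q)) (fun q => φ' (r q)) := fun q x hx h0 =>
  ⟨(h (r q) x hx h0).1,
    ContinuousWithinAt.comp (f := fun z : Q × E3 => (r z.1, z.2)) (x := (q, x))
      (h (r q) x hx h0).2.1 (by fun_prop) (fun z hz => ⟨trivial, hz.2⟩),
    ContinuousWithinAt.comp (f := fun z : Q × E3 => (r z.1, z.2)) (x := (q, x))
      (h (r q) x hx h0).2.2 (by fun_prop) (fun z hz => ⟨trivial, hz.2⟩)⟩

lemma comp_linear (h : C1On K φ φ') (A : E3 →L[ℝ] E3) (hA : ∀ x, A x = 0 → x = 0) :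
    C1On (A ⁻¹' K) (fun q x => φ q (A x)) (fun q x => φ' q (A x) ∘L A) := by
  intro q x hx h0
  obtain ⟨h1, h2, h3⟩ := h q (A x) hx (fun h => h0 (hA x h))
  refine ⟨h1.comp x A.hasFDerivWithinAt (fun y hy => hy),
    ContinuousWithinAt.comp (f := fun z : P × E3 => (z.1, A z.2)) (x := (q, x)) h2
      (by fun_prop) (fun z hz => ⟨trivial, hz.2⟩), ?_⟩
  have h4 := ContinuousWithinAt.comp (f := fun z : P × E3 => (z.1, A z.2)) (x := (q, x))
    (s := Set.univ ×ˢ (A ⁻¹' K)) h3 (by fun_prop) (fun z hz => ⟨trivial, hz.2⟩)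
  exact (((ContinuousLinearMap.compL ℝ E3 E3 V).flip A).continuous.continuousAt
    ).comp_continuousWithinAt h4

lemma of_contDiffAt {f : E3 → V} (hf : ∀ x ≠ 0, ContDiffAt ℝ 1 f x) :
    C1On K (fun _ : P => f) (fun _ => fderiv ℝ f) := fun q x _ h0 =>
  ⟨((hf x h0).differentiableAt one_ne_zero).hasFDerivAt.hasFDerivWithinAt,
    (ContinuousAt.comp (f := fun z : P × E3 => z.2) (x := (q, x)) (hf x h0).continuousAt
      continuousAt_snd).continuousWithinAt,
    (ContinuousAt.comp (f := fun z : P × E3 => z.2) (x := (q, x))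
      ((hf x h0).continuousAt_fderiv one_ne_zero)
      continuousAt_snd).continuousWithinAt⟩

lemma of_param (f : P → V) (hf : Continuous f) :
    C1On K (fun q _ => f q) (fun _ _ => (0 : E3 →L[ℝ] V)) := fun _ _ _ _ =>
  ⟨hasFDerivWithinAt_const _ _ _, (hf.comp continuous_fst).continuousWithinAt,
    continuousWithinAt_const⟩

lemma congr_deriv (h : C1On K φ φ') (e : ∀ q x, x ∈ K → x ≠ 0 → φ' q x = ψ' q x) :
    C1On K φ ψ' := by
  intro q x hx h0
  obtain ⟨h1, h2, h3⟩ := h q x hx h0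
  refine ⟨e q x hx h0 ▸ h1, h2, h3.congr_of_eventuallyEq ?_ (e q x hx h0).symm⟩
  have : {z : P × E3 | z.2 ≠ 0} ∈ nhds (q, x) :=
    (isOpen_ne.preimage continuous_snd).mem_nhds h0
  filter_upwards [self_mem_nhdsWithin, mem_nhdsWithin_of_mem_nhds this] with z hz hz0
  exact (e _ _ hz.2 hz0).symm

/-- Two families on complementary closed half-spaces with the same `1`-jets along their common
boundary glue to a family of `C¹` maps. -/
lemma paste (h : C1On {x : E3 | x 2 ≤ 0} φ φ') (k : C1On {x : E3 | 0 ≤ x 2} ψ ψ')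
    (e : ∀ q (x : E3), x ≠ 0 → x 2 = 0 → φ q x = ψ q x)
    (e' : ∀ q (x : E3), x ≠ 0 → x 2 = 0 → φ' q x = ψ' q x) :
    C1On Set.univ (fun q x => if x 2 ≤ 0 then φ q x else ψ q x)
      (fun q x => if x 2 ≤ 0 then φ' q x else ψ' q x) := by
  have key : ∀ {U : Type _} [TopologicalSpace U] (f g : P → E3 → U)
      (_ : ∀ q x, x ∈ {x : E3 | x 2 ≤ 0} → x ≠ 0 → ContinuousWithinAt (fun z : P × E3 => f z.1 z.2)
        (Set.univ ×ˢ {x : E3 | x 2 ≤ 0}) (q, x))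
      (_ : ∀ q x, x ∈ {x : E3 | 0 ≤ x 2} → x ≠ 0 → ContinuousWithinAt (fun z : P × E3 => g z.1 z.2)
        (Set.univ ×ˢ {x : E3 | 0 ≤ x 2}) (q, x))
      (_ : ∀ q (x : E3), x ≠ 0 → x 2 = 0 → f q x = g q x) (q : P) (x : E3), x ≠ 0 →
      ContinuousAt (fun z : P × E3 => if z.2 2 ≤ 0 then f z.1 z.2 else g z.1 z.2) (q, x) := by
    intro U _ f g hf hg he q x h0
    have hc : ContinuousOn (fun z : P × E3 => if z.2 2 ≤ 0 then f z.1 z.2 else g z.1 z.2)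
        {z : P × E3 | z.2 ≠ 0} := by
      refine ContinuousOn.if ?_ ?_ ?_
      · rintro ⟨q, x⟩ ⟨hx0, hx⟩
        have h2 : x 2 = 0 := by
          have := frontier_le_subset_eq (f := fun z : P × E3 => z.2 2) (g := fun _ => (0 : ℝ))
            (by fun_prop) (by fun_prop) hx
          exact this
        exact he q x hx0 h2
      · rintro ⟨q, x⟩ ⟨hx0, hx⟩
        rw [(isClosed_le (f := fun z : P × E3 => z.2 2) (g := fun _ => (0 : ℝ))
            (by fun_prop) (by fun_prop)).closure_eq] at hx ⊢
        exact (hf q x hx hx0).mono fun z hz => ⟨trivial, hz.2⟩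
      · have hs : closure {z : P × E3 | ¬ z.2 2 ≤ 0} ⊆ {z : P × E3 | 0 ≤ z.2 2} :=
          closure_minimal (fun z hz => (not_le.1 hz).le)
            (isClosed_le (by fun_prop) (by fun_prop))
        rintro ⟨q, x⟩ ⟨hx0, hx⟩
        exact (hg q x (hs hx) hx0).mono fun z hz => ⟨trivial, hs hz.2⟩
    exact hc.continuousAt ((isOpen_ne.preimage continuous_snd).mem_nhds h0)
  intro q x _ h0
  refine ⟨?_, (key φ ψ (fun q x hx h0 => (h q x hx h0).2.1) (fun q x hx h0 => (k q x hx h0).2.1)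
    e q x h0).continuousWithinAt, (key φ' ψ' (fun q x hx h0 => (h q x hx h0).2.2)
    (fun q x hx h0 => (k q x hx h0).2.2) e' q x h0).continuousWithinAt⟩
  have hu : (Set.univ : Set E3) = {x : E3 | x 2 ≤ 0} ∪ {x : E3 | 0 ≤ x 2} := by
    ext y; simpa using le_total (y 2) 0
  rw [hu]
  have hl : ∀ y : E3, y ≠ 0 → 0 ≤ y 2 → (if y 2 ≤ 0 then φ q y else ψ q y) = ψ q y := by
    intro y hy0 hy
    split_ifs with hy'
    · exact e q y hy0 (le_antisymm hy' hy)
    · rfl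
  have hl' : 0 ≤ x 2 → (if x 2 ≤ 0 then φ' q x else ψ' q x) = ψ' q x := by
    intro hx
    split_ifs with hx'
    · exact e' q x h0 (le_antisymm hx' hx)
    · rfl
  refine HasFDerivWithinAt.union ?_ ?_
  · by_cases hx : x 2 ≤ 0
    · simp only [if_pos hx]
      exact (h q x hx h0).1.congr (fun y hy => if_pos hy) (if_pos hx)
    · apply HasFDerivWithinAt.of_notMem_closure
      rwa [(isClosed_le (f := fun z : E3 => z 2) (g := fun _ => (0 : ℝ))
            (by fun_prop) (by fun_prop)).closure_eq]
  · by_cases hx : 0 ≤ x 2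
    · simp only [hl' hx]
      refine (k q x hx h0).1.congr_of_eventuallyEq ?_ (hl x h0 hx)
      filter_upwards [self_mem_nhdsWithin, mem_nhdsWithin_of_mem_nhds (isOpen_ne.mem_nhds h0)]
        with y hy hy0 using hl y hy0 hy
    · apply HasFDerivWithinAt.of_notMem_closure
      rwa [(isClosed_le (f := fun _ : E3 => (0 : ℝ)) (g := fun z => z 2)
            (by fun_prop) (by fun_prop)).closure_eq]

end C1On

end C1Families

section LinearAlgebra

/-- The cross product on Euclidean space. -/
def cr (u v : E3) : E3 := WithLp.toLp 2 (crossProduct u.ofLp v.ofLp)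

lemma cr_eq (u v : E3) :
    cr u v = !₂[u 1 * v 2 - u 2 * v 1, u 2 * v 0 - u 0 * v 2, u 0 * v 1 - u 1 * v 0] := by
  simp [cr, cross_apply]

lemma cr_apply_zero (u v : E3) : cr u v 0 = u 1 * v 2 - u 2 * v 1 := by simp [cr_eq]

lemma cr_apply_one (u v : E3) : cr u v 1 = u 2 * v 0 - u 0 * v 2 := by simp [cr_eq]

lemma cr_apply_two (u v : E3) : cr u v 2 = u 0 * v 1 - u 1 * v 0 := by simp [cr_eq]

lemma continuous_cr {X : Type*} [TopologicalSpace X] {u v : X → E3} (hu : Continuous u)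
    (hv : Continuous v) : Continuous fun x => cr (u x) (v x) := by
  have h : ∀ i, Continuous fun x => (u x) i := fun i => by fun_prop
  have k : ∀ i, Continuous fun x => (v x) i := fun i => by fun_prop
  simp only [cr_eq]
  refine (PiLp.continuous_toLp 2 _).comp (continuous_pi fun i => ?_)
  fin_cases i <;> simp <;> fun_prop

lemma inner_E3 (u v : E3) : inner ℝ u v = u 0 * v 0 + u 1 * v 1 + u 2 * v 2 := by
  simp [PiLp.inner_apply, Fin.sum_univ_three, mul_comm]

lemma sphere_coords (x : S2) : (x : E3) 0 ^ 2 + (x : E3) 1 ^ 2 + (x : E3) 2 ^ 2 = 1 := by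
  have h : ‖(x : E3)‖ = 1 := by simp
  have := real_inner_self_eq_norm_sq (x : E3)
  rw [h, inner_E3] at this
  linarith

lemma sphere_ne_zero (x : S2) : (x : E3) ≠ 0 := by
  intro h
  have h1 : ‖(x : E3)‖ = 1 := by simp
  simp [h] at h1

/-- The generator of rotations about the vertical axis. -/
def lonField (x : E3) : E3 := !₂[-x 1, x 0, 0]

/-- The vector field on the sphere pointing due north. -/
def latField (x : E3) : E3 := !₂[-(x 2 * x 0), -(x 2 * x 1), 1 - x 2 * x 2]

lemma continuous_lonField : Continuous lonField := by
  refine (PiLp.continuous_toLp 2 _).comp (continuous_pi fun i => ?_)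
  fin_cases i <;> simp <;> fun_prop

lemma continuous_latField : Continuous latField := by
  refine (PiLp.continuous_toLp 2 _).comp (continuous_pi fun i => ?_)
  fin_cases i <;> simp <;> fun_prop

/-- The linear map `A` is injective on the plane orthogonal to `x`. -/
def ImmAt (A : E3 →L[ℝ] E3) (x : E3) : Prop := ∀ w : E3, inner ℝ x w = 0 → A w = 0 → w = 0

lemma cr_ne_zero_iff (u v : E3) :
    cr u v ≠ 0 ↔ ∀ s t : ℝ, s • u + t • v = 0 → s = 0 ∧ t = 0 := by
  have h : cr u v ≠ 0 ↔ crossProduct u.ofLp v.ofLp ≠ 0 := by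
    simp [cr]
  rw [h, crossProduct_ne_zero_iff_linearIndependent, LinearIndependent.pair_iff]
  refine forall₂_congr fun s t => ?_
  have : s • u.ofLp + t • v.ofLp = (s • u + t • v).ofLp := rfl
  rw [this, WithLp.ofLp_eq_zero]

lemma immAt_iff_cr_ne_zero (A : E3 →L[ℝ] E3) (x : S2) (hx : (x : E3) 2 ^ 2 ≠ 1) :
    ImmAt A x ↔ cr (A (lonField x)) (A (latField x)) ≠ 0 := by
  have hs := sphere_coords x
  have hr : 1 - (x : E3) 2 ^ 2 ≠ 0 := fun h => hx (by linarith)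
  generalize (x : E3) = y at *
  rw [cr_ne_zero_iff]
  constructor
  · intro h s t hst
    rw [← map_smul, ← map_smul, ← map_add] at hst
    have h0 := h _ (by simp [inner_E3, lonField, latField]; linear_combination (-t * y 2) * hs) hst
    have e0 := congrArg (fun z : E3 => z 0) h0
    have e1 := congrArg (fun z : E3 => z 1) h0
    have e2 := congrArg (fun z : E3 => z 2) h0
    simp [lonField, latField] at e0 e1 e2
    have ht : t = 0 := by
      rcases e2 with e2 | e2
      · exact e2
      · exact absurd (by linarith) hr
    subst ht
    refine ⟨?_, rfl⟩
    simp at e0 e1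
    by_contra hs0
    simp [hs0] at e0 e1
    apply hr
    rw [← hs, e0, e1]; ring
  · intro h w hw hA
    rw [inner_E3] at hw
    have hwe : (1 - y 2 ^ 2) • w = (y 0 * w 1 - y 1 * w 0) • lonField y + w 2 • latField y := by
      ext i
      fin_cases i <;> simp [lonField, latField]
      · linear_combination (-w 0) * hs + y 0 * hw
      · linear_combination (-w 1) * hs + y 1 * hw
      · ring
    have h0 := congrArg A hwe
    simp only [map_smul, map_add, hA, smul_zero] at h0
    obtain ⟨h1, h2⟩ := h _ _ h0.symm
    rw [h1, h2] at hwe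
    simpa [hr] using hwe

/-- The loop `S ↦ v + 2 S² w + S κ`, `S ∈ [-1, 1]`, avoids the line spanned by `u`, if the
detour `κ` in the direction of the normal `n` is long enough. -/
lemma cr_corrugation_ne_zero (u v w : E3) (K S : ℝ) (hS : |S| ≤ 1) (hn : cr u v ≠ 0)
    (hK : 4 * |inner ℝ w (cr u v)| < K * inner ℝ (cr u v) (cr u v) ^ 2) :
    cr u (v + (2 * S ^ 2) • w + (S * K * inner ℝ w (cr (cr u v) u)) • cr u v) ≠ 0 := by
  intro h
  set n := cr u v with hnd
  have hn2 : inner ℝ n n ≠ 0 := by simpa using hn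
  have hu2 : inner ℝ u u ≠ 0 := by
    intro h0
    have : u = 0 := by simpa using h0
    apply hn
    rw [hnd, this]
    ext i
    fin_cases i <;> simp [cr_eq]
  have e1 : inner ℝ n n + 2 * S ^ 2 * inner ℝ w (cr n u) = 0 := by
    have := congrArg (fun z => inner ℝ z n) h
    simp only [inner_zero_left] at this
    rw [← this]
    simp only [inner_E3, cr_apply_zero, cr_apply_one, cr_apply_two, hnd, PiLp.add_apply,
      PiLp.smul_apply, smul_eq_mul]
    ring
  have e2 : inner ℝ u u * (2 * S ^ 2 * inner ℝ w n
      + S * K * inner ℝ w (cr n u) * inner ℝ n n) = 0 := by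
    have := congrArg (fun z => - inner ℝ z (cr n u)) h
    simp only [inner_zero_left, neg_zero] at this
    rw [← this]
    simp only [inner_E3, cr_apply_zero, cr_apply_one, cr_apply_two, hnd, PiLp.add_apply,
      PiLp.smul_apply, smul_eq_mul]
    ring
  have e3 := (mul_eq_zero.1 e2).resolve_left hu2
  have e4 : 4 * S ^ 4 * inner ℝ w n = S * (K * inner ℝ n n ^ 2) := by
    linear_combination 2 * S ^ 2 * e3 - S * K * inner ℝ n n * e1
  have hS0 : S ≠ 0 := by
    rintro rfl
    apply hn2
    linear_combination e1
  have e5 : 4 * S ^ 3 * inner ℝ w n = K * inner ℝ n n ^ 2 := by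
    apply mul_left_cancel₀ hS0
    linear_combination e4
  rw [← e5] at hK
  have e6 : 4 * S ^ 3 * inner ℝ w n ≤ 4 * |inner ℝ w n| := by
    refine (le_abs_self _).trans ?_
    rw [abs_mul, abs_mul, abs_pow, abs_of_pos (by norm_num : (0 : ℝ) < 4)]
    have : |S| ^ 3 ≤ 1 := pow_le_one₀ (abs_nonneg _) hS
    nlinarith [abs_nonneg (inner ℝ w n)]
  linarith

end LinearAlgebra

section Approximation

lemma exists_pos_forall_lt_ne_zero {X : Type*} [TopologicalSpace X] [CompactSpace X] {f : X → E3}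
    {g : X → ℝ} (hf : Continuous f) (hg : Continuous g) (h : ∀ z, g z ≤ 0 → f z ≠ 0) :
    ∃ ε > 0, ∀ z, g z < ε → f z ≠ 0 := by
  have hZ : IsCompact {z | f z = 0} := (isClosed_eq hf continuous_const).isCompact
  rcases Set.eq_empty_or_nonempty {z | f z = 0} with he | hne
  · refine ⟨1, one_pos, fun z _ hz => ?_⟩
    have : z ∈ {z | f z = 0} := hz
    simp [he] at this
  · obtain ⟨z₀, hz₀, hmin⟩ := hZ.exists_isMinOn hne hg.continuousOn
    refine ⟨g z₀, not_le.1 fun h0 => h z₀ h0 hz₀, fun z hz hz0 => ?_⟩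
    exact absurd (hmin hz0) (not_le.2 hz)

/-- Continuous functions which extend to a continuous family of `C¹` functions. -/
def c1Subalgebra (P : Type*) [MetricSpace P] : Subalgebra ℝ C(P × S2, ℝ) where
  carrier := {f | ∃ (φ : P → E3 → ℝ) (φ' : P → E3 → E3 →L[ℝ] ℝ), C1On Set.univ φ φ' ∧
    ∀ q (x : S2), f (q, x) = φ q x}
  mul_mem' := by
    rintro f g ⟨φ, φ', h, hf⟩ ⟨ψ, ψ', k, hg⟩
    exact ⟨_, _, h.smul k, fun q x => by simp [hf, hg]⟩
  add_mem' := by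
    rintro f g ⟨φ, φ', h, hf⟩ ⟨ψ, ψ', k, hg⟩
    exact ⟨_, _, h.add k, fun q x => by simp [hf, hg]⟩
  algebraMap_mem' r := ⟨_, _, C1On.of_param (fun _ => r) continuous_const, fun q x => rfl⟩

lemma c1Subalgebra_separatesPoints {P : Type*} [MetricSpace P] :
    (c1Subalgebra P).SeparatesPoints := by
  rintro ⟨q, x⟩ ⟨q', x'⟩ hne
  by_cases hq : q = q'
  · have hx : (x : E3) ≠ x' := fun h => hne (by rw [hq, Subtype.ext h])
    obtain ⟨i, hi⟩ : ∃ i, (x : E3) i ≠ (x' : E3) i := by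
      by_contra! h
      exact hx (PiLp.ext h)
    refine ⟨_, ⟨⟨fun z => (z.2 : E3) i, by fun_prop⟩,
      ⟨fun _ y => y i, fun _ => fderiv ℝ fun y : E3 => y i, ?_, fun _ _ => rfl⟩, rfl⟩, hi⟩
    exact C1On.of_contDiffAt (fun y _ => by fun_prop)
  · refine ⟨_, ⟨⟨fun z => dist z.1 q', by fun_prop⟩,
      ⟨fun p _ => dist p q', fun _ _ => 0, ?_, fun _ _ => rfl⟩, rfl⟩, ?_⟩
    · exact C1On.of_param _ (by fun_prop)
    · simpa using hq

lemma exists_c1On_near {P : Type*} [MetricSpace P] [CompactSpace P] (A : P × S2 → E3)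
    (hA : Continuous A) {ε : ℝ} (hε : 0 < ε) :
    ∃ (φ : P → E3 → E3) (φ' : P → E3 → E3 →L[ℝ] E3), C1On Set.univ φ φ' ∧
      ∀ q (x : S2), ‖φ q x - A (q, x)‖ < ε := by
  have h := fun i : Fin 3 => ContinuousMap.exists_mem_subalgebra_near_continuous_of_separatesPoints
    (c1Subalgebra P) c1Subalgebra_separatesPoints (fun z => A z i) (by fun_prop) (ε / 3)
    (by positivity)
  choose g hg using h
  choose φ φ' hφ hgφ using fun i => (g i).2
  have hsum : ∀ y : E3, y = y 0 • EuclideanSpace.single 0 1 + y 1 • EuclideanSpace.single 1 1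
      + y 2 • EuclideanSpace.single (2 : Fin 3) (1 : ℝ) := by
    intro y
    ext i
    fin_cases i <;> simp
  have hc : ∀ i : Fin 3, C1On Set.univ (fun (_ : P) (_ : E3) => EuclideanSpace.single i (1 : ℝ))
      (fun _ _ => (0 : E3 →L[ℝ] E3)) := fun i => C1On.of_param _ continuous_const
  refine ⟨_, _, (((hφ 0).smul (hc 0)).add ((hφ 1).smul (hc 1))).add ((hφ 2).smul (hc 2)),
    fun q x => ?_⟩
  set y : E3 := _ - A (q, x) with hy
  have hyi : ∀ i, ‖y i‖ < ε / 3 := by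
    intro i
    have := hg i (q, x)
    rw [hgφ i q x] at this
    fin_cases i <;> simpa [hy] using this
  rw [hsum y]
  refine (norm_add₃_le).trans_lt ?_
  simp only [norm_smul, PiLp.norm_single, norm_one, mul_one]
  linarith [hyi 0, hyi 1, hyi 2]

end Approximation

section Corrugation

lemma continuous_corrugation {X : Type*} [TopologicalSpace X] {u v w m n : X → E3} {S : X → ℝ}
    (K : ℝ) (hu : Continuous u) (hv : Continuous v) (hw : Continuous w) (hm : Continuous m)
    (hn : Continuous n) (hS : Continuous S) :
    Continuous fun x => cr (u x) (v x + (2 * S x ^ 2) • w x +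
      (S x * K * inner ℝ (w x) (m x)) • n x) :=
  continuous_cr hu ((hv.add ((continuous_const.mul (hS.pow 2)).smul hw)).add
    (((hS.mul continuous_const).mul (hw.inner hm)).smul hn))

lemma exists_detour {P : Type*} [MetricSpace P] [CompactSpace P] {B : Set S2} (hB : IsClosed B)
    (u v w : P × S2 → E3) (hu : Continuous u) (hv : Continuous v) (hw : Continuous w) (huv : ∀ q, ∀ x ∈ B, cr (u (q, x)) (v (q, x)) ≠ 0) :
    ∃ (K : ℝ) (m n : P → E3 → E3) (m' n' : P → E3 → E3 →L[ℝ] E3),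
      C1On Set.univ m m' ∧ C1On Set.univ n n' ∧
      ∀ q, ∀ x ∈ B, ∀ S : ℝ, |S| ≤ 1 →
        cr (u (q, x)) (v (q, x) + (2 * S ^ 2) • w (q, x) +
          (S * K * inner ℝ (w (q, x)) (m q x)) • n q x) ≠ 0 := by
  have : CompactSpace B := isCompact_iff_compactSpace.1 hB.isCompact
  have hn₀ : Continuous fun z => cr (u z) (v z) := continuous_cr hu hv
  have hm₀ : Continuous fun z => cr (cr (u z) (v z)) (u z) := continuous_cr hn₀ hu
  obtain ⟨K, hK⟩ : ∃ K : ℝ, ∀ q, ∀ x ∈ B, 4 * |inner ℝ (w (q, x)) (cr (u (q, x)) (v (q, x)))|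
      < K * inner ℝ (cr (u (q, x)) (v (q, x))) (cr (u (q, x)) (v (q, x))) ^ 2 := by
    have hpos : ∀ q, ∀ x ∈ B,
        0 < (inner ℝ (cr (u (q, x)) (v (q, x))) (cr (u (q, x)) (v (q, x))) : ℝ) ^ 2 := by
      intro q x hx
      have : inner ℝ (cr (u (q, x)) (v (q, x))) (cr (u (q, x)) (v (q, x))) ≠ (0 : ℝ) := by
        simpa using huv q x hx
      positivity
    have hj : Continuous fun z : P × B => (z.1, (z.2 : S2)) := by fun_prop
    have hc : Continuous fun z : P × B =>
        4 * |inner ℝ (w (z.1, z.2)) (cr (u (z.1, z.2)) (v (z.1, z.2)))| /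
        (inner ℝ (cr (u (z.1, z.2)) (v (z.1, z.2))) (cr (u (z.1, z.2)) (v (z.1, z.2))) : ℝ) ^ 2 :=
      (continuous_const.mul ((hw.comp hj).inner (hn₀.comp hj)).abs).div
        (((hn₀.comp hj).inner (hn₀.comp hj)).pow 2) fun z => (hpos z.1 z.2 z.2.2).ne'
    obtain ⟨K, hK⟩ := (isCompact_range hc).bddAbove
    refine ⟨K + 1, fun q x hx => ?_⟩
    have h1 := hK ⟨(q, ⟨x, hx⟩), rfl⟩
    rw [div_le_iff₀ (hpos q x hx)] at h1
    have h2 := hpos q x hx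
    linarith
  obtain ⟨ε, hε, H⟩ := exists_pos_forall_lt_ne_zero
    (X := P × B × Set.Icc (-1 : ℝ) 1 × closedBall (0 : E3) 1 × closedBall (0 : E3) 1)
    (f := fun z => cr (u (z.1, z.2.1)) (v (z.1, z.2.1) +
      (2 * (z.2.2.1 : ℝ) ^ 2) • w (z.1, z.2.1) +
      ((z.2.2.1 : ℝ) * K * inner ℝ (w (z.1, z.2.1))
        (cr (cr (u (z.1, z.2.1)) (v (z.1, z.2.1))) (u (z.1, z.2.1)) + z.2.2.2.1)) •
        (cr (u (z.1, z.2.1)) (v (z.1, z.2.1)) + z.2.2.2.2)))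
    (g := fun z => ‖(z.2.2.2.1 : E3)‖ + ‖(z.2.2.2.2 : E3)‖)
    (by
      have hj : Continuous fun z : P × B × Set.Icc (-1 : ℝ) 1 × closedBall (0 : E3) 1 ×
        closedBall (0 : E3) 1 => (z.1, (z.2.1 : S2)) := by fun_prop
      have h1 := hu.comp hj
      have h2 := hv.comp hj
      have h3 := hw.comp hj
      have h4 := hn₀.comp hj
      have h5 := hm₀.comp hj
      simp only [Function.comp_def] at h1 h2 h3 h4 h5
      exact continuous_corrugation K h1 h2 h3
        (h5.add (continuous_subtype_val.comp
          (continuous_snd.comp continuous_snd |>.comp continuous_snd |> continuous_fst.comp)))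
        (h4.add (continuous_subtype_val.comp
          (continuous_snd.comp continuous_snd |>.comp continuous_snd |> continuous_snd.comp)))
        (continuous_subtype_val.comp (continuous_fst.comp (continuous_snd.comp continuous_snd))))
    (((continuous_subtype_val.comp
          (continuous_snd.comp continuous_snd |>.comp continuous_snd |> continuous_fst.comp))).norm.add
      ((continuous_subtype_val.comp
          (continuous_snd.comp continuous_snd |>.comp continuous_snd |> continuous_snd.comp))).norm)
    (by
      rintro ⟨q, ⟨x, hx⟩, ⟨S, hS⟩, ⟨e₁, _⟩, ⟨e₂, _⟩⟩ hz
      have h1 : e₁ = 0 := norm_le_zero_iff.1 (by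
        have := norm_nonneg e₂; simp only at hz; linarith)
      have h2 : e₂ = 0 := norm_le_zero_iff.1 (by
        have := norm_nonneg e₁; simp only at hz; linarith)
      subst h1 h2
      simpa using cr_corrugation_ne_zero _ _ _ K S (abs_le.2 hS) (huv q x hx) (hK q x hx))
  obtain ⟨m, m', hm, hm2⟩ := exists_c1On_near _ hm₀ (ε := min (ε / 2) 1) (by positivity)
  obtain ⟨n, n', hn, hn2⟩ := exists_c1On_near _ hn₀ (ε := min (ε / 2) 1) (by positivity)
  refine ⟨K, m, n, m', n', hm, hn, fun q x hx S hS => ?_⟩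
  have h1 := hm2 q x
  have h2 := hn2 q x
  rw [lt_min_iff] at h1 h2
  have := H ⟨q, ⟨x, hx⟩, ⟨S, abs_le.1 hS⟩, ⟨_, mem_closedBall_zero_iff.2 h1.2.le⟩,
    ⟨_, mem_closedBall_zero_iff.2 h2.2.le⟩⟩ (by simp only; linarith)
  simpa using this

lemma C1On.of_height {P : Type*} [TopologicalSpace P] {ψ : ℝ → ℝ} (hψ : ContDiff ℝ 1 ψ) :
    C1On Set.univ (fun (_ : P) (x : E3) => ψ (x 2))
      (fun _ x => deriv ψ (x 2) • EuclideanSpace.proj (2 : Fin 3)) := by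
  have hp : ∀ x : E3, HasFDerivAt (fun x : E3 => x 2)
    (EuclideanSpace.proj (2 : Fin 3) : E3 →L[ℝ] ℝ) x := fun x =>
    (EuclideanSpace.proj (2 : Fin 3) : E3 →L[ℝ] ℝ).hasFDerivAt
  refine (C1On.of_contDiffAt (f := fun x : E3 => ψ (x 2)) fun x _ => ?_).congr_deriv ?_
  · exact (hψ.comp (by fun_prop)).contDiffAt
  · intro _ x _ _
    exact ((hψ.differentiable one_ne_zero (x 2)).hasDerivAt.comp_hasFDerivAt x (hp x)).fderiv

end Corrugation

section Step

lemma exists_cutoff {δ : ℝ} (hδ : 0 < δ) : ∃ χ : ℝ → ℝ, ContDiff ℝ 2 χ ∧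
    (∀ s, χ s ∈ Set.Icc (0 : ℝ) 1) ∧ (∀ s < δ / 3, χ s = 1) ∧ ∀ s, 2 * δ / 3 ≤ s → χ s = 0 := by
  refine ⟨fun s => Real.smoothTransition (2 - 3 * s / δ), ?_,
    fun s => ⟨Real.smoothTransition.nonneg _, Real.smoothTransition.le_one _⟩, fun s hs => ?_, fun s hs => ?_⟩
  · exact Real.smoothTransition.contDiff.comp (by fun_prop)
  · apply Real.smoothTransition.one_of_one_le
    have : 3 * s / δ ≤ 1 := by rw [div_le_one hδ]; linarith
    linarith
  · apply Real.smoothTransition.zero_of_nonpos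
    have : 2 ≤ 3 * s / δ := by rw [le_div_iff₀ hδ]; linarith
    linarith

lemma continuous_perturbation {X : Type*} [TopologicalSpace X] {u v w a b c d e : X → E3}
    {S T C η : X → ℝ} (hu : Continuous u) (hv : Continuous v) (hw : Continuous w)
    (ha : Continuous a) (hb : Continuous b) (hc : Continuous c) (hd : Continuous d)
    (he : Continuous e) (hS : Continuous S) (hT : Continuous T) (hC : Continuous C)
    (hη : Continuous η) :
    Continuous fun x => cr (u x - η x • (T x • a x + C x • b x))
      (v x + (2 * S x ^ 2) • w x + S x • e x - η x • (T x • c x + C x • d x)) :=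
  continuous_cr (hu.sub (hη.smul ((hT.smul ha).add (hC.smul hb))))
    (((hv.add ((continuous_const.mul (hS.pow 2)).smul hw)).add (hS.smul he)).sub
      (hη.smul ((hT.smul hc).add (hC.smul hd))))

/-- A high-frequency corrugation perturbs the horizontal derivative little, and moves the vertical
derivative along the loop given by `exists_detour`. -/
lemma exists_frequency {P : Type*} [MetricSpace P] [CompactSpace P] {B : Set S2} (hB : IsClosed B)
    (u v w a b c d e : P × S2 → E3)
    (hu : Continuous u) (hv : Continuous v) (hw : Continuous w) (ha : Continuous a)
    (hb : Continuous b) (hc : Continuous c) (hd : Continuous d) (he : Continuous e)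
    (h : ∀ q, ∀ x ∈ B, ∀ S : ℝ, |S| ≤ 1 →
      cr (u (q, x)) (v (q, x) + (2 * S ^ 2) • w (q, x) + S • e (q, x)) ≠ 0) :
    ∃ η > (0 : ℝ), ∀ q, ∀ x ∈ B, ∀ S T C : ℝ, |S| ≤ 1 → |T| ≤ 1 → |C| ≤ 1 →
      cr (u (q, x) - η • (T • a (q, x) + C • b (q, x)))
        (v (q, x) + (2 * S ^ 2) • w (q, x) + S • e (q, x) -
          η • (T • c (q, x) + C • d (q, x))) ≠ 0 := by
  have : CompactSpace B := isCompact_iff_compactSpace.1 hB.isCompact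
  let I := Set.Icc (-1 : ℝ) 1
  obtain ⟨ε, hε, H⟩ := exists_pos_forall_lt_ne_zero
    (X := (P × B) × I × I × I × Set.Icc (0 : ℝ) 1)
    (f := fun z => cr (u (z.1.1, z.1.2) - (z.2.2.2.2 : ℝ) •
        ((z.2.2.1 : ℝ) • a (z.1.1, z.1.2) + (z.2.2.2.1 : ℝ) • b (z.1.1, z.1.2)))
        (v (z.1.1, z.1.2) + (2 * (z.2.1 : ℝ) ^ 2) • w (z.1.1, z.1.2) +
          (z.2.1 : ℝ) • e (z.1.1, z.1.2) -
          (z.2.2.2.2 : ℝ) •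
            ((z.2.2.1 : ℝ) • c (z.1.1, z.1.2) + (z.2.2.2.1 : ℝ) • d (z.1.1, z.1.2))))
    (g := fun z => (z.2.2.2.2 : ℝ))
    (by
      have hj : Continuous fun z : (P × B) × I × I × I × Set.Icc (0 : ℝ) 1 =>
        (z.1.1, (z.1.2 : S2)) :=
          (continuous_fst.comp continuous_fst).prodMk
            (continuous_subtype_val.comp (continuous_snd.comp continuous_fst))
      exact continuous_perturbation (hu.comp hj) (hv.comp hj) (hw.comp hj) (ha.comp hj)
        (hb.comp hj) (hc.comp hj) (hd.comp hj) (he.comp hj)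
        (continuous_subtype_val.comp (continuous_fst.comp continuous_snd))
        (continuous_subtype_val.comp (continuous_fst.comp (continuous_snd.comp continuous_snd)))
        (continuous_subtype_val.comp (continuous_fst.comp
          (continuous_snd.comp (continuous_snd.comp continuous_snd))))
        (continuous_subtype_val.comp (continuous_snd.comp
          (continuous_snd.comp (continuous_snd.comp continuous_snd)))))
    (continuous_subtype_val.comp (continuous_snd.comp
      (continuous_snd.comp (continuous_snd.comp continuous_snd))))
    (by
      rintro ⟨⟨q, ⟨x, hx⟩⟩, ⟨S, hS⟩, ⟨T, _⟩, ⟨C, _⟩, ⟨η, hη⟩⟩ hz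
      have : η = 0 := le_antisymm hz hη.1
      subst this
      simpa using h q x hx S (abs_le.2 hS))
  refine ⟨min (ε / 2) (1 : ℝ), by positivity, fun q x hx S T C hS hT hC => ?_⟩
  have h0 : 0 ≤ min (ε / 2) (1 : ℝ) := by positivity
  exact H ⟨⟨q, ⟨x, hx⟩⟩, ⟨S, abs_le.1 hS⟩, ⟨T, abs_le.1 hT⟩, ⟨C, abs_le.1 hC⟩,
    ⟨_, h0, min_le_right _ _⟩⟩ ((min_le_left _ _).trans_lt (by linarith))

lemma C1On.deriv_eq_of_eqOn {P : Type*} [TopologicalSpace P] {φ ψ : P → E3 → E3}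
    {φ' ψ' : P → E3 → E3 →L[ℝ] E3} (h : C1On Set.univ φ φ') (k : C1On Set.univ ψ ψ')
    {U : Set E3} (hU : IsOpen U) {q : P} (he : ∀ x ∈ U, φ q x = ψ q x) {x : E3} (hx : x ∈ U)
    (h0 : x ≠ 0) : φ' q x = ψ' q x :=
  (h.hasFDerivAt q h0).unique ((k.hasFDerivAt q h0).congr_of_eventuallyEq
    (Filter.eventually_of_mem (hU.mem_nhds hx) he))

lemma corrugation_identity {η : ℝ} (hη : η ≠ 0) (A B D a k b : E3) (χ χ' s S T C : ℝ) :
    A + (χ • B + (χ' * s) • D) - η • ((1 / 2 * T) • a +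
      (η⁻¹ * (1 - 2 * S ^ 2) * s) • χ' • D + (C • b + (-(η⁻¹ * S) * s) • k)) =
    A + χ • B + (2 * S ^ 2) • s • χ' • D + S • s • k - η • (T • (1 / 2 : ℝ) • a + C • b) := by
  match_scalars <;> field_simp
  ring

theorem exists_extension_step {P : Type*} [MetricSpace P] [CompactSpace P]
    {F₀ F₁ G₀ : P → E3 → E3} {F₀' F₁' G₀' : P → E3 → E3 →L[ℝ] E3}
    (hF₀ : C1On Set.univ F₀ F₀') (hF₁ : C1On Set.univ F₁ F₁') (hG₀ : C1On Set.univ G₀ G₀')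
    {δ : ℝ} (hδ : 0 < δ) (hδ1 : δ < 1) (hGF : ∀ q (x : E3), x 2 < δ → G₀ q x = F₀ q x)
    (hGimm : ∀ q (x : S2), ImmAt (G₀' q x) x)
    (hFimm : ∀ q (x : S2), (x : E3) 2 ≤ 0 → ImmAt (F₁' q x) x)
    (hcol : ∀ q (x : S2), 0 ≤ (x : E3) 2 → (x : E3) 2 ≤ δ → ∀ r ∈ Set.Icc (0 : ℝ) 1,
      cr ((F₀' q x + r • (F₁' q x - F₀' q x)) (lonField x))
        ((F₀' q x + r • (F₁' q x - F₀' q x)) (latField x)) ≠ 0) :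
    ∃ δ' > 0, δ' ≤ δ ∧ ∃ (G₁ : P → E3 → E3) (G₁' : P → E3 → E3 →L[ℝ] E3), C1On Set.univ G₁ G₁' ∧
      (∀ q (x : S2), ImmAt (G₁' q x) x) ∧ (∀ q (x : E3), x 2 < δ' → G₁ q x = F₁ q x) ∧
      ∀ q, F₀ q = F₁ q → G₁ q = G₀ q := by
  obtain ⟨χ, hχ, hχI, hχ1, hχ0⟩ := exists_cutoff hδ
  have hχd : ContDiff ℝ 1 (deriv χ) := by
    have : ContDiff ℝ (1 + 1) χ := by simpa [one_add_one_eq_two] using hχ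
    exact (contDiff_succ_iff_deriv.1 this).2.2
  have hχd1 : ∀ s < δ / 3, deriv χ s = 0 := by
    intro s hs
    have : χ =ᶠ[nhds s] fun _ => 1 := Filter.eventually_of_mem (isOpen_Iio.mem_nhds hs) hχ1
    rw [this.deriv_eq, deriv_const]
  have hχd0 : ∀ s, 2 * δ / 3 < s → deriv χ s = 0 := by
    intro s hs
    have : χ =ᶠ[nhds s] fun _ => 0 := Filter.eventually_of_mem (isOpen_Ioi.mem_nhds hs)
      fun t ht => hχ0 t (le_of_lt ht)
    rw [this.deriv_eq, deriv_const]
  have hc := C1On.of_height (P := P) (hχ.of_le one_le_two)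
  have hD := hF₁.sub hF₀
  have hcD := hc.smul hD
  have hw := (C1On.of_height (P := P) hχd).smul hD
  set D : P → E3 → E3 := fun q x => F₁ q x - F₀ q x with hDdef
  set D' : P → E3 → E3 →L[ℝ] E3 := fun q x => F₁' q x - F₀' q x with hD'def
  set w : P → E3 → E3 := fun q x => deriv χ (x 2) • D q x with hwdef
  obtain ⟨w', hw⟩ : ∃ w', C1On Set.univ w w' := ⟨_, hw⟩
  have hi : Continuous fun z : P × S2 => (z.2 : E3) := by fun_prop
  have hi2 : Continuous fun z : P × S2 => (z.2 : E3) 2 := by fun_prop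
  have hi0 : ∀ z : P × S2, (z.2 : E3) ≠ 0 := fun z => sphere_ne_zero _
  have hlon := continuous_lonField.comp hi
  have hlat := continuous_latField.comp hi
  have cF := hF₀.continuous_deriv_comp continuous_fst hi hi0
  have cD' := hD.continuous_deriv_comp continuous_fst hi hi0
  have cw := hw.continuous_comp continuous_fst hi hi0
  have cw' := hw.continuous_deriv_comp continuous_fst hi hi0
  have cA : Continuous fun z : P × S2 => F₀' z.1 z.2 + χ ((z.2 : E3) 2) • D' z.1 z.2 :=
    cF.add ((hχ.continuous.comp hi2).smul cD')
  set B : Set S2 := {x | 0 ≤ (x : E3) 2 ∧ (x : E3) 2 ≤ 2 * δ / 3} with hBdef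
  have hc2 : Continuous fun x : S2 => (x : E3) 2 := by fun_prop
  have hB : IsClosed B :=
    (isClosed_le continuous_const hc2).inter (isClosed_le hc2 continuous_const)
  have ca : Continuous fun z : P × S2 => (1 - (z.2 : E3) 2 * (z.2 : E3) 2) :=
    continuous_const.sub (hi2.mul hi2)
  obtain ⟨K, m, n, m', n', hm, hn, H1⟩ := exists_detour hB
    (fun z : P × S2 => (F₀' z.1 z.2 + χ ((z.2 : E3) 2) • D' z.1 z.2) (lonField z.2))
    (fun z : P × S2 => (F₀' z.1 z.2 + χ ((z.2 : E3) 2) • D' z.1 z.2) (latField z.2))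
    (fun z : P × S2 => (1 - (z.2 : E3) 2 * (z.2 : E3) 2) • w z.1 z.2)
    (cA.clm_apply hlon) (cA.clm_apply hlat) (ca.smul cw)
    (fun q x hx => hcol q x hx.1 (hx.2.trans (by linarith)) _ (hχI _))
  have hκ := (((hw.bilin (innerSL ℝ) hm).const_smul K).smul hn)
  set κ : P → E3 → E3 := fun q x => (K • innerSL ℝ (w q x) (m q x)) • n q x with hκdef
  obtain ⟨κ', hκ⟩ : ∃ κ', C1On Set.univ κ κ' := ⟨_, hκ⟩
  have cκ := hκ.continuous_comp continuous_fst hi hi0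
  have cκ' := hκ.continuous_deriv_comp continuous_fst hi hi0
  have cw1 : Continuous fun z : P × S2 => (1 / 2 : ℝ) • w' z.1 z.2 (lonField z.2) :=
    (cw'.clm_apply hlon).const_smul (1 / 2 : ℝ)
  have cw2 : Continuous fun z : P × S2 => (1 / 2 : ℝ) • w' z.1 z.2 (latField z.2) :=
    (cw'.clm_apply hlat).const_smul (1 / 2 : ℝ)
  obtain ⟨η, hη, H2⟩ := exists_frequency hB
    (fun z : P × S2 => (F₀' z.1 z.2 + χ ((z.2 : E3) 2) • D' z.1 z.2) (lonField z.2))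
    (fun z : P × S2 => (F₀' z.1 z.2 + χ ((z.2 : E3) 2) • D' z.1 z.2) (latField z.2))
    (fun z : P × S2 => (1 - (z.2 : E3) 2 * (z.2 : E3) 2) • w z.1 z.2)
    (fun z => (1 / 2 : ℝ) • w' z.1 z.2 (lonField z.2)) (fun z => κ' z.1 z.2 (lonField z.2))
    (fun z => (1 / 2 : ℝ) • w' z.1 z.2 (latField z.2)) (fun z => κ' z.1 z.2 (latField z.2))
    (fun z : P × S2 => (1 - (z.2 : E3) 2 * (z.2 : E3) 2) • κ z.1 z.2)
    (cA.clm_apply hlon) (cA.clm_apply hlat) (ca.smul cw)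
    cw1 (cκ'.clm_apply hlon)
    cw2 (cκ'.clm_apply hlat) (ca.smul cκ)
    (fun q x hx S hS => by
      convert H1 q x hx S hS using 3
      simp only [hκdef, smul_smul, innerSL_apply_apply, real_inner_smul_left, smul_eq_mul]
      congr 1
      ring)
  have hp := C1On.of_height (P := P) (ψ := fun s => 1 / 2 * Real.sin (2 * (s / η)))
    (by fun_prop)
  have hr := C1On.of_height (P := P) (ψ := fun s => Real.cos (s / η)) (by fun_prop)
  have hpd : ∀ s, deriv (fun s => 1 / 2 * Real.sin (2 * (s / η))) s
      = η⁻¹ * Real.cos (2 * (s / η)) := by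
    intro s
    have h1 : HasDerivAt (fun s => 2 * (s / η)) (2 * (1 / η)) s :=
      ((hasDerivAt_id s).div_const η).const_mul 2
    rw [(h1.sin.const_mul (1 / 2)).deriv]
    ring
  have hrd : ∀ s, deriv (fun s => Real.cos (s / η)) s = - (η⁻¹ * Real.sin (s / η)) := by
    intro s
    have h1 : HasDerivAt (fun s => s / η) (1 / η) s := (hasDerivAt_id s).div_const η
    rw [h1.cos.deriv]
    ring
  have hG := (hG₀.add hcD).sub (((hp.smul hw).add (hr.smul hκ)).const_smul η)
  have hw0 : ∀ q (x : E3), deriv χ (x 2) = 0 → w q x = 0 := fun q x hx => by simp [hwdef, hx]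
  have hκ0 : ∀ q (x : E3), w q x = 0 → κ q x = 0 := fun q x hx => by simp [hκdef, hx]
  have hlow : ∀ q (x : E3), x 2 < δ / 3 → G₀ q x + χ (x 2) • D q x -
      η • ((1 / 2 * Real.sin (2 * (x 2 / η))) • w q x + Real.cos (x 2 / η) • κ q x) =
      F₁ q x := fun q x hx => by
    have hwx := hw0 q x (hχd1 _ hx)
    rw [hκ0 q x hwx, hwx, hχ1 _ hx, hGF q x (by linarith)]
    simp [hDdef]
  refine ⟨δ / 3, by positivity, by linarith, _, _, hG, fun q x => ?_, hlow, fun q hq => ?_⟩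
  · have hx0 := sphere_ne_zero x
    by_cases hx1 : (x : E3) 2 ≤ 0
    · rw [C1On.deriv_eq_of_eqOn hG hF₁ (U := {x : E3 | x 2 < δ / 3})
        (isOpen_lt (by fun_prop) (by fun_prop)) (hlow q)
        (by simp only [Set.mem_ofPred_eq]; linarith) hx0]
      exact hFimm q x hx1
    by_cases hx2 : 2 * δ / 3 < (x : E3) 2
    · rw [C1On.deriv_eq_of_eqOn hG hG₀ (U := {x : E3 | 2 * δ / 3 < x 2})
        (isOpen_lt (by fun_prop) (by fun_prop)) (fun y hy => ?_) hx2 hx0]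
      · exact hGimm q x
      · have hwy := hw0 q y (hχd0 _ hy)
        simp only [hκ0 q y hwy, hwy, hχ0 _ (le_of_lt hy)]
        simp
    push Not at hx1 hx2
    rw [immAt_iff_cr_ne_zero _ _ (by nlinarith)]
    have hG₀F : G₀' q x = F₀' q x := C1On.deriv_eq_of_eqOn hG₀ hF₀ (U := {x : E3 | x 2 < δ})
        (isOpen_lt (by fun_prop) (by fun_prop)) (hGF q) (by simp only [Set.mem_ofPred_eq]; linarith)
        hx0
    have key := H2 q x ⟨hx1.le, hx2⟩ (Real.sin ((x : E3) 2 / η)) (Real.sin (2 * ((x : E3) 2 / η)))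
      (Real.cos ((x : E3) 2 / η)) (Real.abs_sin_le_one _) (Real.abs_sin_le_one _)
      (Real.abs_cos_le_one _)
    have e0 : (EuclideanSpace.proj (2 : Fin 3) : E3 →L[ℝ] ℝ) (lonField x) = 0 := by
      simp [lonField]
    have e1 : (EuclideanSpace.proj (2 : Fin 3) : E3 →L[ℝ] ℝ) (latField x)
      = 1 - (x : E3) 2 * (x : E3) 2 := by
      simp [latField]
    have hcos : Real.cos (2 * ((x : E3) 2 / η)) = 1 - 2 * Real.sin ((x : E3) 2 / η) ^ 2 := by
      rw [Real.cos_two_mul, Real.cos_sq']; ring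
    have hη0 : η ≠ 0 := ne_of_gt hη
    convert key using 2
    · rw [hG₀F]
      simp only [add_apply, sub_apply, smul_apply,
        ContinuousLinearMap.smulRight_apply, e0, hD'def]
      module
    · rw [hG₀F]
      simp only [add_apply, sub_apply, smul_apply,
        ContinuousLinearMap.smulRight_apply, e1, hpd, hrd, hcos, hwdef,
        hD'def, hDdef, smul_eq_mul]
      exact corrugation_identity hη0 _ _ _ _ _ _ _ _ _ _ _ _
  · funext x
    have hDx : D q x = 0 := by simp [hDdef, hq]
    have hwx : w q x = 0 := by simp [hwdef, hDx]
    change G₀ q x + χ (x 2) • D q x - η • (_ • w q x + _ • κ q x) = _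
    simp [hκ0 q x hwx, hwx, hDx]

end Step

section Lifting

variable {C : Type*} [MetricSpace C] [CompactSpace C]

lemma exists_collar {F' : C × unitInterval → E3 → E3 →L[ℝ] E3} {F : C × unitInterval → E3 → E3}
    (hF : C1On Set.univ F F') (himm : ∀ q (x : S2), (x : E3) 2 ≤ 0 → ImmAt (F' q x) x) :
    ∃ ε > (0 : ℝ), ∀ c (t t' : unitInterval) (x : S2), |(t : ℝ) - t'| < ε → 0 ≤ (x : E3) 2 →
      (x : E3) 2 ≤ 1 / 2 → (x : E3) 2 < ε → ∀ r ∈ Set.Icc (0 : ℝ) 1,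
      cr ((F' (c, t) x + r • (F' (c, t') x - F' (c, t) x)) (lonField x))
        ((F' (c, t) x + r • (F' (c, t') x - F' (c, t) x)) (latField x)) ≠ 0 := by
  have hc2 : Continuous fun x : S2 => (x : E3) 2 := by fun_prop
  let B : Set S2 := {x | 0 ≤ (x : E3) 2 ∧ (x : E3) 2 ≤ 1 / 2}
  have hB : IsClosed B :=
    (isClosed_le continuous_const hc2).inter (isClosed_le hc2 continuous_const)
  have : CompactSpace B := isCompact_iff_compactSpace.1 hB.isCompact
  let X := C × unitInterval × unitInterval × Set.Icc (0 : ℝ) 1 × B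
  have h1 : Continuous fun z : X => z.1 := continuous_fst
  have h2 : Continuous fun z : X => z.2.1 := continuous_fst.comp continuous_snd
  have h3 : Continuous fun z : X => z.2.2.1 :=
    continuous_fst.comp (continuous_snd.comp continuous_snd)
  have h4 : Continuous fun z : X => (z.2.2.2.1 : ℝ) := continuous_subtype_val.comp
    (continuous_fst.comp (continuous_snd.comp (continuous_snd.comp continuous_snd)))
  have h5 : Continuous fun z : X => (z.2.2.2.2 : S2) := continuous_subtype_val.comp
    (continuous_snd.comp (continuous_snd.comp (continuous_snd.comp continuous_snd)))
  have h6 : Continuous fun z : X => ((z.2.2.2.2 : S2) : E3) := continuous_subtype_val.comp h5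
  have h0 : ∀ z : X, ((z.2.2.2.2 : S2) : E3) ≠ 0 := fun z => sphere_ne_zero _
  have k1 := hF.continuous_deriv_comp (h1.prodMk h2) h6 h0
  have k2 := hF.continuous_deriv_comp (h1.prodMk h3) h6 h0
  have kA := k1.add (h4.smul (k2.sub k1))
  obtain ⟨ε, hε, H⟩ := exists_pos_forall_lt_ne_zero (X := X)
    (f := fun z => cr ((F' (z.1, z.2.1) z.2.2.2.2 + (z.2.2.2.1 : ℝ) •
        (F' (z.1, z.2.2.1) z.2.2.2.2 - F' (z.1, z.2.1) z.2.2.2.2)) (lonField z.2.2.2.2))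
      ((F' (z.1, z.2.1) z.2.2.2.2 + (z.2.2.2.1 : ℝ) •
        (F' (z.1, z.2.2.1) z.2.2.2.2 - F' (z.1, z.2.1) z.2.2.2.2)) (latField z.2.2.2.2)))
    (g := fun z => max |(z.2.1 : ℝ) - z.2.2.1| (((z.2.2.2.2 : S2) : E3) 2))
    (continuous_cr (kA.clm_apply (continuous_lonField.comp h6))
      (kA.clm_apply (continuous_latField.comp h6)))
    (((continuous_subtype_val.comp h2).sub (continuous_subtype_val.comp h3)).abs.max
      (hc2.comp h5))
    (by
      rintro ⟨c, t, t', ⟨r, hr⟩, ⟨x, hx⟩⟩ hz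
      obtain ⟨hz1, hz2⟩ := max_le_iff.1 hz
      have ht : t = t' := Subtype.ext (sub_eq_zero.1 (abs_nonpos_iff.1 hz1))
      subst ht
      have hx2 : (x : E3) 2 = 0 := le_antisymm hz2 hx.1
      simpa using (immAt_iff_cr_ne_zero _ x (by simp [hx2])).1 (himm (c, t) x hz2))
  exact ⟨ε, hε, fun c t t' x ht hx0 hx1 hx r hr =>
    H ⟨c, t, t', ⟨r, hr⟩, ⟨x, hx0, hx1⟩⟩ (max_lt ht hx)⟩

/-- A family of maps of the sphere which are immersions near the southern hemisphere, and
immersions of the whole sphere at time `0`, can be modified away from the southern hemisphere to a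
family of immersions of the whole sphere. -/
theorem exists_immersions_of_south {F : C × unitInterval → E3 → E3}
    {F' : C × unitInterval → E3 → E3 →L[ℝ] E3} (hF : C1On Set.univ F F')
    (himm : ∀ q (x : S2), (x : E3) 2 ≤ 0 → ImmAt (F' q x) x)
    (himm0 : ∀ c (x : S2), ImmAt (F' (c, 0) x) x) :
    ∃ (G : C × unitInterval → E3 → E3) (G' : C × unitInterval → E3 → E3 →L[ℝ] E3),
      C1On Set.univ G G' ∧ (∀ q (x : S2), ImmAt (G' q x) x) ∧ (∀ c, G (c, 0) = F (c, 0)) ∧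
      ∃ δ > (0 : ℝ), ∀ q (x : E3), x 2 < δ → G q x = F q x := by
  obtain ⟨ε, hε, hcol⟩ := exists_collar hF himm
  obtain ⟨M, hM⟩ := exists_nat_one_div_lt hε
  have hM0 : (0 : ℝ) < M + 1 := by positivity
  let T : ℕ → unitInterval := fun i =>
    ⟨min 1 (i / (M + 1)), le_min zero_le_one (by positivity), min_le_left _ _⟩
  have hT0 : T 0 = 0 := Subtype.ext (by simp [T])
  have hT1 : T (M + 1) = 1 := Subtype.ext (by simp [T, div_self hM0.ne'])
  have hTd : ∀ i (t : unitInterval), |((min t (T i) : unitInterval) : ℝ) -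
      (min t (T (i + 1)) : unitInterval)| < ε := by
    intro i t
    have hmin : ∀ s : unitInterval, ((min t s : unitInterval) : ℝ) = min (t : ℝ) s := fun s =>
      (Subtype.mono_coe _).map_min
    rw [hmin, hmin]
    refine (abs_min_sub_min_le_max _ _ _ _).trans_lt (max_lt (by simpa using hε) ?_)
    refine (abs_min_sub_min_le_max _ _ _ _).trans_lt (max_lt (by simpa using hε) ?_)
    have : ((i : ℝ) / (M + 1) - ((i + 1 : ℕ) : ℝ) / (M + 1)) = - (1 / (M + 1)) := by
      push_cast; ring
    rw [this, abs_neg, abs_of_pos (by positivity)]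
    exact hM
  have hr : ∀ i, Continuous fun q : C × unitInterval => (q.1, min q.2 (T i)) := fun i =>
    continuous_fst.prodMk (continuous_snd.min continuous_const)
  have key : ∀ i, ∃ δ > (0 : ℝ), δ ≤ 1 / 2 ∧ δ < ε ∧ ∃ (G : C × unitInterval → E3 → E3)
      (G' : C × unitInterval → E3 → E3 →L[ℝ] E3),
      C1On Set.univ G G' ∧ (∀ q (x : S2), ImmAt (G' q x) x) ∧ (∀ c, G (c, 0) = F (c, 0)) ∧
      ∀ q (x : E3), x 2 < δ → G q x = F (q.1, min q.2 (T i)) x := by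
    intro i
    induction i with
    | zero =>
      refine ⟨min (1 / 2) (ε / 2), by positivity, min_le_left _ _,
        (min_le_right _ _).trans_lt (by linarith), _, _, hF.reparam (hr 0), fun q x => ?_,
        fun c => ?_, fun q x _ => rfl⟩
      · simpa [hT0] using himm0 q.1 x
      · simp [hT0]
    | succ i ih =>
      obtain ⟨δ, hδ, hδ1, hδε, G, G', hG, hGimm, hG0, hGF⟩ := ih
      obtain ⟨δ', hδ', hle, G₁, G₁', hG₁, hG₁imm, hG₁F, hG₁0⟩ :=
        exists_extension_step (hF.reparam (hr i)) (hF.reparam (hr (i + 1))) hG hδ (by linarith)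
          hGF hGimm (fun q x hx => himm _ x hx)
          (fun q x hx0 hx r hr => hcol q.1 _ _ x (hTd i q.2) hx0 (hx.trans hδ1)
            (hx.trans_lt hδε) r hr)
      refine ⟨δ', hδ', hle.trans hδ1, hle.trans_lt hδε, G₁, G₁', hG₁, hG₁imm, fun c => ?_, hG₁F⟩
      rw [hG₁0 (c, 0) (by simp), hG0]
  obtain ⟨δ, hδ, -, -, G, G', hG, hGimm, hG0, hGF⟩ := key (M + 1)
  refine ⟨G, G', hG, hGimm, hG0, δ, hδ, fun q x hx => ?_⟩
  rw [hGF q x hx, hT1, min_eq_left (show q.2 ≤ 1 from q.2.2.2)]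

end Lifting

section Jets

/-- The radial projection onto the sphere. -/
def radialProj (x : E3) : S2 :=
  if h : x = 0 then ⟨EuclideanSpace.single 2 1, by simp⟩
  else ⟨‖x‖⁻¹ • x, by simp [norm_smul, h]⟩

lemma coe_radialProj {x : E3} (h : x ≠ 0) : (radialProj x : E3) = ‖x‖⁻¹ • x := by
  simp [radialProj, h]

lemma radialProj_coe (x : S2) : radialProj x = x := by
  apply Subtype.ext
  rw [coe_radialProj (sphere_ne_zero x)]
  simp

lemma contMDiffAt_radialProj {x : E3} (h : x ≠ 0) :
    ContMDiffAt 𝓘(ℝ, E3) (𝓡 2) 1 radialProj x := by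
  let U : TopologicalSpace.Opens E3 := ⟨{0}ᶜ, isOpen_compl_singleton⟩
  have hU : ∀ y : U, (y : E3) ≠ 0 := fun y => y.2
  have hf : ContMDiff 𝓘(ℝ, E3) 𝓘(ℝ, E3) 1 (fun y : U => ((radialProj y : S2) : E3)) := by
    intro y
    refine (contMDiffAt_subtype_iff (f := fun y : E3 => ((radialProj y : S2) : E3))).2 ?_
    refine ContMDiffAt.congr_of_eventuallyEq (f := fun y : E3 => ‖y‖⁻¹ • y) ?_ ?_
    · exact ((contDiffAt_id.norm ℝ (hU y)).inv (norm_ne_zero_iff.2 (hU y))).smul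
        contDiffAt_id |>.contMDiffAt
    · filter_upwards [isOpen_ne.mem_nhds (hU y)] with z hz using coe_radialProj hz
  have hg := hf.codRestrict_sphere (n := 2) fun y => (radialProj y).2
  exact (contMDiffAt_subtype_iff (U := U) (f := radialProj) (x := ⟨x, h⟩)).1 (hg ⟨x, h⟩)

/-- The trivialisation of the tangent bundle of `ℝ³`. -/
def trivE3 : TB' ≃ₜ E3 × E3 := tangentBundleModelSpaceHomeomorph 𝓘(ℝ, E3)

lemma continuous_tm_stdEmb : Continuous (tm stdEmb) :=
  (contMDiff_coe_sphere (m := 1)).continuous_tangentMap le_rfl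

/-- The inclusion of the tangent bundle of the sphere in the tangent bundle of `ℝ³`. -/
def tangentIncl (v : TB) : E3 := (trivE3 (tm stdEmb v)).2

lemma continuous_tangentIncl : Continuous tangentIncl :=
  continuous_snd.comp (trivE3.continuous.comp continuous_tm_stdEmb)

lemma inner_tangentIncl (v : TB) : inner ℝ (v.proj : E3) (tangentIncl v) = 0 := by
  have h : tangentIncl v ∈ (mvfderiv (𝓡 2) ((↑) : sphere (0 : E3) 1 → E3) v.proj).range := ⟨v.2, rfl⟩
  rw [range_mvfderiv_subtypeVal (n := 2)] at h
  exact Submodule.mem_orthogonal_singleton_iff_inner_right.1 h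

lemma exists_tangentIncl_eq (x : S2) {w : E3} (hw : inner ℝ (x : E3) w = 0) :
    ∃ v : TangentSpace (𝓡 2) x, tangentIncl ⟨x, v⟩ = w := by
  have h : w ∈ (mvfderiv (𝓡 2) ((↑) : sphere (0 : E3) 1 → E3) x).range := by
    rw [range_mvfderiv_subtypeVal (n := 2)]
    exact Submodule.mem_orthogonal_singleton_iff_inner_right.2 hw
  obtain ⟨v, hv⟩ := h
  exact ⟨v, hv⟩

/-- The differential of the radial projection. -/
def tangentRadial (x w : E3) : TB := tangentMap 𝓘(ℝ, E3) (𝓡 2) radialProj (trivE3.symm (x, w))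

lemma mdifferentiableAt_radialProj {x : E3} (h : x ≠ 0) :
    MDifferentiableAt 𝓘(ℝ, E3) (𝓡 2) radialProj x :=
  (contMDiffAt_radialProj h).mdifferentiableAt one_ne_zero

lemma continuousOn_tangentRadial :
    ContinuousOn (fun z : E3 × E3 => tangentRadial z.1 z.2) {z | z.1 ≠ 0} := by
  have h : ContMDiffOn 𝓘(ℝ, E3) (𝓡 2) 1 radialProj {0}ᶜ := fun x hx =>
    (contMDiffAt_radialProj hx).contMDiffWithinAt
  have hu : UniqueMDiffOn 𝓘(ℝ, E3) ({0}ᶜ : Set E3) := isOpen_compl_singleton.uniqueMDiffOn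
  have h2 := h.continuousOn_tangentMapWithin le_rfl hu
  refine ContinuousOn.congr (f := (tangentMapWithin 𝓘(ℝ, E3) (𝓡 2) radialProj {0}ᶜ) ∘ trivE3.symm)
    (h2.comp trivE3.symm.continuous.continuousOn fun z hz => hz) fun z hz => ?_
  have hz0 : z.1 ≠ 0 := hz
  exact (tangentMapWithin_eq_tangentMap (p := trivE3.symm z) (hu z.1 hz0)
    (mdifferentiableAt_radialProj hz0)).symm

lemma tangentRadial_tangentIncl (v : TB) : tangentRadial v.proj (tangentIncl v) = v := by
  have h := tangentMap_comp_at (I := 𝓡 2) (I' := 𝓘(ℝ, E3)) (I'' := 𝓡 2) (f := stdEmb)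
    (g := radialProj) v (mdifferentiableAt_radialProj (sphere_ne_zero v.proj))
    ((contMDiff_coe_sphere (m := 1)).mdifferentiable one_ne_zero v.proj)
  have hid : radialProj ∘ stdEmb = id := funext radialProj_coe
  rw [hid, tangentMap_id] at h
  exact h.symm

lemma tm_tangentRadial {f : S2 → E3} {x : E3} (hx : x ≠ 0)
    (hf : MDifferentiableAt (𝓡 2) 𝓘(ℝ, E3) f (radialProj x)) (w : E3) :
    tm f (tangentRadial x w) =
      trivE3.symm (f (radialProj x), fderiv ℝ (fun y => f (radialProj y)) x w) := by
  have h := tangentMap_comp_at (I := 𝓘(ℝ, E3)) (I' := 𝓡 2) (I'' := 𝓘(ℝ, E3)) (f := radialProj)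
    (g := f) (trivE3.symm (x, w)) hf (mdifferentiableAt_radialProj hx)
  refine h.symm.trans ?_
  simp only [tangentMap, mfderiv_eq_fderiv]
  rfl

lemma tm_comp_coe {F : E3 → E3} {F' : E3 →L[ℝ] E3} (v : TB) (h : HasFDerivAt F F' v.proj) :
    tm (fun x : S2 => F x) v = trivE3.symm (F v.proj, F' (tangentIncl v)) := by
  have hc := tangentMap_comp_at (I := 𝓡 2) (I' := 𝓘(ℝ, E3)) (I'' := 𝓘(ℝ, E3)) (f := stdEmb)
    (g := F) v h.differentiableAt.mdifferentiableAt
    ((contMDiff_coe_sphere (m := 1)).mdifferentiable one_ne_zero v.proj)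
  refine hc.trans ?_
  rw [← h.fderiv]
  simp only [tangentMap, mfderiv_eq_fderiv]
  rfl

end Jets

section Dictionary

variable {X : Type*} [TopologicalSpace X] {A B : Set S2}

instance : LocallyCompactSpace TB :=
  have : LocallyCompactSpace (ModelProd (EuclideanSpace ℝ (Fin 2)) (EuclideanSpace ℝ (Fin 2))) :=
    inferInstanceAs (LocallyCompactSpace (EuclideanSpace ℝ (Fin 2) × EuclideanSpace ℝ (Fin 2)))
  ChartedSpace.locallyCompactSpace (ModelProd (EuclideanSpace ℝ (Fin 2)) (EuclideanSpace ℝ (Fin 2)))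
    TB

lemma continuous_proj : Continuous (fun v : TB => v.proj) :=
  FiberBundle.continuous_proj (EuclideanSpace ℝ (Fin 2)) (TangentSpace (𝓡 2))

lemma continuous_immGerm_eval (hA : IsClosed A) {Γ : X → ImmGerm A B} (hΓ : Continuous Γ) :
    Continuous (fun z : X × {v : TB // v.proj ∈ A} => (Γ z.1).1 z.2) := by
  have : LocallyCompactSpace {v : TB // v.proj ∈ A} :=
    (hA.preimage continuous_proj).isClosedEmbedding_subtypeVal.locallyCompactSpace
  exact ContinuousEval.continuous_eval.comp
    ((continuous_subtype_val.comp (hΓ.comp continuous_fst)).prodMk continuous_snd)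

lemma injective_mfderiv_iff (f : S2 → E3) (x : S2) :
    Injective (mfderiv (𝓡 2) 𝓘(ℝ, E3) f x) ↔
      ∀ v : TangentSpace (𝓡 2) x, (trivE3 (tm f ⟨x, v⟩)).2 = 0 → tangentIncl ⟨x, v⟩ = 0 := by
  have h0 : tangentIncl ⟨x, 0⟩ = 0 :=
    map_zero (mfderiv (𝓡 2) 𝓘(ℝ, E3) ((↑) : sphere (0 : E3) 1 → E3) x)
  refine (injective_iff_map_eq_zero (mfderiv (𝓡 2) 𝓘(ℝ, E3) f x)).trans
    (forall_congr' fun v => imp_congr Iff.rfl ⟨fun h => h ▸ h0, fun h => ?_⟩)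
  have h1 := tangentRadial_tangentIncl ⟨x, v⟩
  rw [h, ← h0] at h1
  have h2 := h1.symm.trans (tangentRadial_tangentIncl ⟨x, 0⟩)
  exact eq_of_heq (TotalSpace.mk.inj h2).2

/-- A continuous family of immersion germs extends radially to a continuous family of maps defined
on a cone. -/
lemma exists_c1On_of_immGerm {K : Set E3} (hA : IsClosed A)
    (hK : ∀ x ∈ K, x ≠ 0 → radialProj x ∈ A) {Γ : X → ImmGerm A B} (hΓ : Continuous Γ) :
    ∃ (φ : X → E3 → E3) (φ' : X → E3 → E3 →L[ℝ] E3), C1On K φ φ' ∧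
      (∀ q x w (hx : x ∈ K) (h0 : x ≠ 0),
        (Γ q).1 ⟨tangentRadial x w, hK x hx h0⟩ = trivE3.symm (φ q x, φ' q x w)) ∧
      ∀ q (x : S2), x ∈ A → ImmAt (φ' q x) x := by
  choose f U hU hAU hf hinj hjet hB using fun q => (Γ q).2
  have hfd : ∀ q x, radialProj x ∈ A → MDifferentiableAt (𝓡 2) 𝓘(ℝ, E3) (f q) (radialProj x) :=
    fun q x hx => ((hf q).contMDiffAt ((hU q).mem_nhds (hAU q hx))).mdifferentiableAt one_ne_zero
  let φ : X → E3 → E3 := fun q x => f q (radialProj x)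
  let φ' : X → E3 → E3 →L[ℝ] E3 := fun q => fderiv ℝ (φ q)
  have key : ∀ q x w, x ≠ 0 → radialProj x ∈ A →
      tm (f q) (tangentRadial x w) = trivE3.symm (φ q x, φ' q x w) :=
    fun q x w h0 hx => tm_tangentRadial h0 (hfd q x hx) w
  have hΓφ : ∀ q x w (hx : x ∈ K) (h0 : x ≠ 0),
      (Γ q).1 ⟨tangentRadial x w, hK x hx h0⟩ = trivE3.symm (φ q x, φ' q x w) :=
    fun q x w hx h0 => (hjet q _).trans (key q x w h0 (hK x hx h0))
  have hcont : ∀ w, ContinuousOn (fun z : X × E3 => (φ z.1 z.2, φ' z.1 z.2 w))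
      (Set.univ ×ˢ (K \ {0})) := by
    intro w
    rw [continuousOn_iff_continuous_domRestrict]
    have h1 : Continuous fun z : (Set.univ ×ˢ (K \ {0}) : Set (X × E3)) =>
        tangentRadial z.1.2 w := by
      refine continuousOn_tangentRadial.comp_continuous
        (f := fun z : (Set.univ ×ˢ (K \ {0}) : Set (X × E3)) => (z.1.2, w)) (by fun_prop) ?_
      exact fun z => z.2.2.2
    have h2 := trivE3.continuous.comp ((continuous_immGerm_eval hA hΓ).comp
      ((continuous_fst.comp continuous_subtype_val).prodMk (h1.subtype_mk
        fun z => hK z.1.2 z.2.2.1 z.2.2.2)))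
    convert h2 using 1
    funext z
    exact (trivE3.apply_symm_apply _).symm.trans
      (congrArg trivE3 (hΓφ z.1.1 z.1.2 w z.2.2.1 z.2.2.2).symm)
  have hnhds : ∀ (q : X) (x : E3), x ≠ 0 →
      (Set.univ ×ˢ (K \ {0}) : Set (X × E3)) ∈ nhdsWithin (q, x) (Set.univ ×ˢ K) := by
    intro q x h0
    have : {z : X × E3 | z.2 ≠ 0} ∈ nhds (q, x) :=
      (isOpen_ne.preimage continuous_snd).mem_nhds h0
    filter_upwards [self_mem_nhdsWithin, mem_nhdsWithin_of_mem_nhds this] with z hz hz0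
    exact ⟨trivial, hz.2, hz0⟩
  refine ⟨φ, φ', fun q x hx h0 => ⟨?_, ?_, ?_⟩, hΓφ, ?_⟩
  · have := (hfd q x (hK x hx h0)).comp x (mdifferentiableAt_radialProj h0)
    exact this.differentiableAt.hasFDerivAt.hasFDerivWithinAt
  · exact ((hcont 0).fst (q, x) ⟨trivial, hx, h0⟩).mono_of_mem_nhdsWithin (hnhds q x h0)
  · have h : ContinuousOn (fun z : X × E3 => φ' z.1 z.2) (Set.univ ×ˢ (K \ {0})) :=
      continuousOn_clm_apply.2 fun w => (hcont w).snd
    exact (h (q, x) ⟨trivial, hx, h0⟩).mono_of_mem_nhdsWithin (hnhds q x h0)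
  · intro q x hx w hw hw'
    obtain ⟨v, rfl⟩ := exists_tangentIncl_eq x hw
    refine (injective_mfderiv_iff (f q) x).1 (hinj q x hx) v ?_
    have hr : radialProj x ∈ A := by rwa [radialProj_coe]
    have h := key q x (tangentIncl ⟨x, v⟩) (sphere_ne_zero x) hr
    have h' : tangentRadial x (tangentIncl ⟨x, v⟩) = ⟨x, v⟩ := tangentRadial_tangentIncl ⟨x, v⟩
    rw [h'] at h
    rw [h, trivE3.apply_symm_apply]
    exact hw'

lemma C1On.contDiffOn {F : X → E3 → E3} {F' : X → E3 → E3 →L[ℝ] E3}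
    (hF : C1On Set.univ F F') (q : X) : ContDiffOn ℝ 1 (F q) {0}ᶜ := by
  refine fun x hx => ContDiffAt.contDiffWithinAt (contDiffAt_one_iff.2 ⟨F' q, {0}ᶜ,
    isOpen_compl_singleton.mem_nhds hx, fun y hy => ?_, fun y hy => hF.hasFDerivAt q hy⟩)
  exact ((hF.continuousAt_deriv q hy).comp (f := fun z => (q, z))
    (by fun_prop)).continuousWithinAt

/-- A continuous family of maps of punctured space which restrict to immersions of the sphere
defines a continuous family of immersions of the sphere. -/
lemma exists_immGerm_of_c1On {F : X → E3 → E3} {F' : X → E3 → E3 →L[ℝ] E3}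
    (hF : C1On Set.univ F F') (himm : ∀ q (x : S2), ImmAt (F' q x) x)
    (hB : ∀ q (v : TB), v.proj ∈ B →
      trivE3.symm (F q v.proj, F' q v.proj (tangentIncl v)) = tm stdEmb v) :
    ∃ Γ : X → ImmGerm Set.univ B, Continuous Γ ∧ ∀ q v,
      (Γ q).1 v = trivE3.symm (F q v.1.proj, F' q v.1.proj (tangentIncl v.1)) := by
  have htm : ∀ q v, tm (fun x : S2 => F q x) v =
      trivE3.symm (F q v.proj, F' q v.proj (tangentIncl v)) :=
    fun q v => tm_comp_coe v (hF.hasFDerivAt q (sphere_ne_zero v.proj))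
  have hc : Continuous fun z : X × {v : TB // v.proj ∈ (Set.univ : Set S2)} =>
      trivE3.symm (F z.1 z.2.1.proj, F' z.1 z.2.1.proj (tangentIncl z.2.1)) := by
    have h1 : Continuous fun z : X × {v : TB // v.proj ∈ (Set.univ : Set S2)} =>
        (z.2.1.proj : E3) :=
      continuous_subtype_val.comp (continuous_proj.comp (continuous_subtype_val.comp continuous_snd))
    refine trivE3.symm.continuous.comp
      ((hF.continuous_comp continuous_fst h1 fun z => sphere_ne_zero _).prodMk
      ((hF.continuous_deriv_comp continuous_fst h1 fun z => sphere_ne_zero _).clm_apply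
      (continuous_tangentIncl.comp (continuous_subtype_val.comp continuous_snd))))
  let γ : X → C({v : TB // v.proj ∈ (Set.univ : Set S2)}, TB') := fun q =>
    ⟨fun v => trivE3.symm (F q v.1.proj, F' q v.1.proj (tangentIncl v.1)),
      hc.comp (Continuous.prodMk_right q)⟩
  refine ⟨fun q => ⟨γ q, fun x => F q x, Set.univ, isOpen_univ, subset_rfl, ?_, ?_,
    fun v => (htm q v).symm, fun v hv => (htm q v).trans (hB q v hv)⟩,
    (ContinuousMap.continuous_of_continuous_uncurry γ hc).subtype_mk _, fun q v => rfl⟩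
  · have h1 := (hF.contDiffOn q).contMDiffOn
    exact h1.comp (contMDiff_coe_sphere (n := 2) (m := 1)).contMDiffOn fun x _ => sphere_ne_zero x
  · intro x _
    rw [injective_mfderiv_iff]
    intro v hv
    rw [htm, trivE3.apply_symm_apply] at hv
    exact himm q x _ (inner_tangentIncl ⟨x, v⟩) hv

end Dictionary

section Restriction

variable {A B : Set S2}

lemma immGerm_eq_stdEmb (Γ : ImmGerm A B) (v : {v : TB // v.proj ∈ A}) (hv : v.1.proj ∈ B) :
    Γ.1 v = tm stdEmb v.1 := by
  obtain ⟨f, U, -, -, -, -, hf, hB⟩ := Γ.2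
  rw [hf, hB _ hv]

/-- The restriction to `A` of an immersion of the sphere which is standard along `B`. -/
def restrictImm {B' : Set S2} (A B : Set S2) (G : ImmGerm Set.univ B')
    (h : ∀ v : {v : TB // v.proj ∈ Set.univ}, v.1.proj ∈ B → G.1 v = tm stdEmb v.1) :
    ImmGerm A B :=
  ⟨G.1.comp ⟨fun v => ⟨v.1, Set.mem_univ _⟩, by fun_prop⟩, by
    obtain ⟨f, U, hU, hAU, hf, hinj, hjet, -⟩ := G.2
    exact ⟨f, U, hU, (Set.subset_univ A).trans hAU, hf, fun x _ => hinj x trivial,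
      fun v => hjet ⟨v.1, trivial⟩, fun v hv => (hjet ⟨v, trivial⟩).symm.trans (h ⟨v, trivial⟩ hv)⟩⟩

lemma eval_of_tangentRadial {X : Type*} [TopologicalSpace X] {K : Set E3}
    {hK : ∀ x ∈ K, x ≠ 0 → radialProj x ∈ A} {Γ : X → ImmGerm A B}
    {φ : X → E3 → E3} {φ' : X → E3 → E3 →L[ℝ] E3}
    (h : ∀ q x w (hx : x ∈ K) (h0 : x ≠ 0),
        (Γ q).1 ⟨tangentRadial x w, hK x hx h0⟩ = trivE3.symm (φ q x, φ' q x w))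
    (q : X) (v : {v : TB // v.proj ∈ A}) (hv : (v.1.proj : E3) ∈ K) :
    (Γ q).1 v = trivE3.symm (φ q v.1.proj, φ' q v.1.proj (tangentIncl v.1)) := by
  rw [← h q _ _ hv (sphere_ne_zero _)]
  exact congrArg _ (Subtype.ext (tangentRadial_tangentIncl v.1).symm)

lemma radialProj_apply_two {x : E3} (h : x ≠ 0) : (radialProj x : E3) 2 = ‖x‖⁻¹ * x 2 := by
  rw [coe_radialProj h]
  rfl

lemma radialProj_mem_HS {x : E3} (hx : x ∈ {x : E3 | x 2 ≤ 0}) (h : x ≠ 0) :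
    radialProj x ∈ HS := by
  change (radialProj x : E3) 2 ≤ 0
  rw [radialProj_apply_two h]
  exact mul_nonpos_of_nonneg_of_nonpos (by positivity) hx

lemma radialProj_mem_HN {x : E3} (hx : x ∈ {x : E3 | 0 ≤ x 2}) (h : x ≠ 0) :
    radialProj x ∈ HN := by
  change 0 ≤ (radialProj x : E3) 2
  rw [radialProj_apply_two h]
  exact mul_nonneg (by positivity) hx

lemma isClosed_HS : IsClosed HS :=
  isClosed_le (f := fun x : S2 => (x : E3) 2) (g := fun _ => (0 : ℝ)) (by fun_prop) (by fun_prop)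

lemma isClosed_HN : IsClosed HN :=
  isClosed_le (f := fun _ => (0 : ℝ)) (g := fun x : S2 => (x : E3) 2) (by fun_prop) (by fun_prop)

/-- The linear map `(x, y, z) ↦ (x, y, a z)`. -/
def scaleLast (a : ℝ) : E3 →L[ℝ] E3 :=
  ContinuousLinearMap.id ℝ E3 +
    (a - 1) • (EuclideanSpace.proj (2 : Fin 3) : E3 →L[ℝ] ℝ).smulRight (EuclideanSpace.single 2 1)

lemma scaleLast_apply (a : ℝ) (x : E3) :
    scaleLast a x = x + ((a - 1) * x 2) • EuclideanSpace.single 2 (1 : ℝ) := by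
  simp [scaleLast, mul_smul]

lemma scaleLast_apply_two (a : ℝ) (x : E3) : scaleLast a x 2 = a * x 2 := by
  rw [scaleLast_apply]
  simp
  ring

lemma scaleLast_eq_zero {a : ℝ} (ha : a ≠ 0) (x : E3) (h : scaleLast a x = 0) : x = 0 := by
  have h2 : x 2 = 0 := by
    have := scaleLast_apply_two a x
    rw [h] at this
    simpa [ha] using this.symm
  rw [scaleLast_apply, h2] at h
  simpa using h

/-- Reflection across the boundary extends `C¹` families from the lower half-space. -/
lemma C1On.exists_reflection {P V : Type*} [TopologicalSpace P] [NormedAddCommGroup V]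
    [NormedSpace ℝ V] {φ : P → E3 → V} {φ' : P → E3 → E3 →L[ℝ] V}
    (h : C1On {x : E3 | x 2 ≤ 0} φ φ') :
    ∃ (ψ : P → E3 → V) (ψ' : P → E3 → E3 →L[ℝ] V), C1On Set.univ ψ ψ' ∧
      (∀ q (x : E3), x 2 ≤ 0 → ψ q x = φ q x ∧ ψ' q x = φ' q x) ∧
      ∀ q, (∀ x, φ q x = 0) → ∀ x, ψ q x = 0 := by
  have hs : ∀ a : ℝ, a < 0 → C1On {x : E3 | 0 ≤ x 2} (fun q x => φ q (scaleLast a x))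
      (fun q x => φ' q (scaleLast a x) ∘L scaleLast a) := fun a ha =>
    (h.comp_linear (scaleLast a) (fun x => scaleLast_eq_zero ha.ne x)).mono fun x hx => by
      change scaleLast a x 2 ≤ 0
      rw [scaleLast_apply_two]
      exact mul_nonpos_of_nonpos_of_nonneg ha.le hx
  have hfix : ∀ (a : ℝ) (x : E3), x 2 = 0 → scaleLast a x = x := fun a x hx => by
    simp [scaleLast_apply, hx]
  have hpaste := h.paste (((hs (-1) (by norm_num)).const_smul 3).sub
    ((hs (-2) (by norm_num)).const_smul 2)) (fun q x _ hx => ?_) (fun q x _ hx => ?_)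
  · refine ⟨_, _, hpaste, fun q x hx => ⟨if_pos hx, if_pos hx⟩, fun q hq x => ?_⟩
    simp [hq]
  · simp only [hfix _ x hx]
    module
  · simp only [hfix _ x hx]
    ext w
    simp only [sub_apply, smul_apply,
      ContinuousLinearMap.comp_apply, scaleLast_apply, map_add, map_smul]
    module

end Restriction

section Fibration

lemma isSerreFibration_restriction {p : S2} (hp : p ∈ EqS)
    (ρ : ImmGerm Set.univ {p} → ImmGerm HS {p})
    (hρ : ∀ (G : ImmGerm Set.univ {p}) (v : {v : TB // v.proj ∈ HS}),
      (ρ G).1 v = G.1 ⟨v.1, Set.mem_univ _⟩) : IsSerreFibration ρ := by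
  intro n H g hH hg hgH
  obtain ⟨γ, γ', hγ, hγe, hγi⟩ := exists_c1On_of_immGerm (K := Set.univ) isClosed_univ
    (fun _ _ _ => trivial) hg
  obtain ⟨η, η', hη, hηe, hηi⟩ := exists_c1On_of_immGerm isClosed_HS
    (fun x => radialProj_mem_HS) hH
  have hγη : ∀ c (x : E3) w, x 2 ≤ 0 → x ≠ 0 →
      γ c x = η (c, 0) x ∧ γ' c x w = η' (c, 0) x w := by
    intro c x w hx h0
    rw [← Prod.mk.injEq]
    apply trivE3.symm.injective
    rw [← hγe c x w trivial h0, ← hηe (c, 0) x w hx h0, ← hgH, hρ]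
  obtain ⟨ψ, ψ', hψ, hψe, hψ0⟩ := (hη.sub (hη.reparam
    (r := fun q : (Fin n → unitInterval) × unitInterval => (q.1, 0))
    (by fun_prop))).exists_reflection
  have hF := (hγ.reparam
    (r := fun q : (Fin n → unitInterval) × unitInterval => q.1) continuous_fst).add hψ
  set F : (Fin n → unitInterval) × unitInterval → E3 → E3 := fun q x => γ q.1 x + ψ q x with hFdef
  set F' : (Fin n → unitInterval) × unitInterval → E3 → E3 →L[ℝ] E3 :=
    fun q x => γ' q.1 x + ψ' q x with hF'def
  have hFη : ∀ q (x : E3), x 2 ≤ 0 → x ≠ 0 → F q x = η q x := by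
    intro q x hx h0
    simp [hFdef, (hψe q x hx).1, (hγη q.1 x 0 hx h0).1]
  have hFη' : ∀ q (x : E3), x 2 ≤ 0 → x ≠ 0 → F' q x = η' q x := by
    intro q x hx h0
    ext1 w
    simp [hF'def, (hψe q x hx).2, (hγη q.1 x w hx h0).2]
  have hF0 : ∀ c, F (c, 0) = γ c := fun c => funext fun x => by
    simp [hFdef, hψ0 (c, 0) (fun x => sub_self _)]
  have hF0' : ∀ c (x : E3), x ≠ 0 → F' (c, 0) x = γ' c x := fun c x h0 =>
    (hF.hasFDerivAt (c, 0) h0).unique (hF0 c ▸ hγ.hasFDerivAt c h0)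
  obtain ⟨G, G', hG, hGi, hG0, δ, hδ, hGF⟩ := exists_immersions_of_south hF
    (fun q x hx => hFη' q x hx (sphere_ne_zero x) ▸ hηi q x hx)
    (fun c x => hF0' c x (sphere_ne_zero x) ▸ hγi c x trivial)
  have hGF' : ∀ q (x : E3), x 2 < δ → x ≠ 0 → G' q x = F' q x := fun q x hx h0 =>
    hG.deriv_eq_of_eqOn hF (isOpen_lt (f := fun x : E3 => x 2) (by fun_prop) continuous_const)
      (fun y hy => hGF q y hy) hx h0
  have hGH : ∀ q (v : {v : TB // v.proj ∈ HS}),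
      trivE3.symm (G q v.1.proj, G' q v.1.proj (tangentIncl v.1)) = (H q).1 v := by
    intro q v
    have h2 : (v.1.proj : E3) 2 ≤ 0 := v.2
    have h0 := sphere_ne_zero v.1.proj
    rw [hGF q _ (h2.trans_lt hδ), hGF' q _ (h2.trans_lt hδ) h0, hFη q _ h2 h0, hFη' q _ h2 h0]
    exact (eval_of_tangentRadial hηe q v h2).symm
  obtain ⟨L, hL, hLe⟩ := exists_immGerm_of_c1On (B := {p}) hG hGi fun q v hv => by
    have hv' : v.proj ∈ HS := by
      rw [Set.mem_singleton_iff.1 hv]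
      exact le_of_eq hp
    exact (hGH q ⟨v, hv'⟩).trans (immGerm_eq_stdEmb (H q) ⟨v, hv'⟩ hv)
  refine ⟨L, hL, fun c => Subtype.ext (ContinuousMap.ext fun v => ?_),
    fun q => Subtype.ext (ContinuousMap.ext fun v => ?_)⟩
  · have h0 := sphere_ne_zero v.1.proj
    rw [hLe, eval_of_tangentRadial hγe c v trivial, hG0, hF0,
      (hG.hasFDerivAt (c, 0) h0).unique
        (((hG0 c).trans (hF0 c)) ▸ hγ.hasFDerivAt c h0)]
  · rw [hρ, hLe]
    exact hGH q v

end Fibration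

section Fibre

/-- An immersion of the northern hemisphere which is standard along the equator extends by the
standard embedding to the sphere, continuously in the immersion. -/
lemma exists_extend_stdEmb {p : S2} (hp : p ∈ EqS) :
    ∃ Γ : ImmGerm HN EqS → ImmGerm Set.univ {p}, Continuous Γ ∧
      (∀ q (v : {v : TB // v.proj ∈ HN}), (Γ q).1 ⟨v.1, trivial⟩ = q.1 v) ∧
      ∀ q (v : {v : TB // v.proj ∈ Set.univ}), v.1.proj ∈ HS → (Γ q).1 v = tm stdEmb v.1 := by
  obtain ⟨η, η', hη, hηe, hηi⟩ := exists_c1On_of_immGerm isClosed_HN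
    (fun x => radialProj_mem_HN) (continuous_id (X := ImmGerm HN EqS))
  have hstd : ∀ x ≠ 0, ContDiffAt ℝ 1 (fun x : E3 => (radialProj x : E3)) x := fun x hx =>
    ((contMDiff_coe_sphere (m := 1) (n := 2)).contMDiffAt.comp x
      (contMDiffAt_radialProj hx)).contDiffAt
  have hstde : ∀ (x : E3) w, x ≠ 0 → tm stdEmb (tangentRadial x w) =
      trivE3.symm (radialProj x, fderiv ℝ (fun x : E3 => (radialProj x : E3)) x w) :=
    fun x w h0 => tm_tangentRadial h0
      ((contMDiff_coe_sphere (m := 1)).mdifferentiable one_ne_zero _) w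
  have hstdv : ∀ v : TB, tm stdEmb v = trivE3.symm ((radialProj v.proj : E3),
      fderiv ℝ (fun x : E3 => (radialProj x : E3)) v.proj (tangentIncl v)) := fun v => by
    rw [← hstde _ _ (sphere_ne_zero _), tangentRadial_tangentIncl]
  have hagree : ∀ q (x : E3) w, x ≠ 0 → x 2 = 0 →
      ((radialProj x : E3), fderiv ℝ (fun x : E3 => (radialProj x : E3)) x w) =
        (η q x, η' q x w) := by
    intro q x w h0 hx
    apply trivE3.symm.injective
    rw [← hstde x w h0, ← hηe q x w hx.ge h0]
    refine (immGerm_eq_stdEmb q ⟨tangentRadial x w, radialProj_mem_HN hx.ge h0⟩ ?_).symm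
    change (radialProj x : E3) 2 = 0
    rw [radialProj_apply_two h0, hx, mul_zero]
  have hF := (C1On.of_contDiffAt (P := ImmGerm HN EqS) (K := {x : E3 | x 2 ≤ 0}) hstd).paste hη
    (fun q x h0 hx => (Prod.ext_iff.1 (hagree q x 0 h0 hx)).1)
    (fun q x h0 hx => ContinuousLinearMap.ext fun w => (Prod.ext_iff.1 (hagree q x w h0 hx)).2)
  set F : ImmGerm HN EqS → E3 → E3 := fun q x => if x 2 ≤ 0 then (radialProj x : E3) else η q x
    with hFdef
  set F' : ImmGerm HN EqS → E3 → E3 →L[ℝ] E3 := fun q x =>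
    if x 2 ≤ 0 then fderiv ℝ (fun x : E3 => (radialProj x : E3)) x else η' q x with hF'def
  have hS : ∀ q (v : TB), v.proj ∈ HS →
      trivE3.symm (F q v.proj, F' q v.proj (tangentIncl v)) = tm stdEmb v := by
    intro q v hv
    have hv' : (v.proj : E3) 2 ≤ 0 := hv
    simp only [hFdef, hF'def, if_pos hv', hstdv]
  have himm : ∀ q (x : S2), ImmAt (F' q x) x := by
    intro q x
    by_cases hx : (x : E3) 2 ≤ 0
    · intro w hw h
      obtain ⟨v, rfl⟩ := exists_tangentIncl_eq x hw
      have h1 := congrArg trivE3 (hS q ⟨x, v⟩ hx)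
      rw [trivE3.apply_symm_apply] at h1
      exact (Prod.ext_iff.1 h1).2.symm.trans h
    · simp only [hF'def, if_neg hx]
      exact hηi q x (not_le.1 hx).le
  obtain ⟨Γ, hΓ, hΓe⟩ := exists_immGerm_of_c1On (B := {p}) hF himm fun q v hv => hS q v (by
    rw [Set.mem_singleton_iff.1 hv]
    exact le_of_eq hp)
  refine ⟨Γ, hΓ, fun q v => ?_, fun q v hv => (hΓe q v).trans (hS q v.1 hv)⟩
  rw [hΓe]
  by_cases hv : v.1.proj ∈ HS
  · rw [hS q v.1 hv]
    exact (immGerm_eq_stdEmb q v (le_antisymm hv v.2)).symm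
  · have hv' : ¬ (v.1.proj : E3) 2 ≤ 0 := hv
    simp only [hFdef, hF'def, if_neg hv']
    exact (eval_of_tangentRadial hηe q v v.2).symm

/-- The immersions of the sphere which are standard on the southern hemisphere are the immersions
of the northern hemisphere which are standard along the equator. -/
lemma nonempty_fibre_homeomorph {p : S2} (hp : p ∈ EqS) :
    Nonempty
      (({G : ImmGerm Set.univ {p} //
          ∀ v : {v : TB // v.proj ∈ Set.univ}, v.1.proj ∈ HS → G.1 v = tm stdEmb v.1}) ≃ₜ
        ImmGerm HN EqS) := by
  obtain ⟨Γ, hΓ, hN, hS⟩ := exists_extend_stdEmb hp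
  refine ⟨⟨⟨fun G => restrictImm HN EqS G.1 fun v hv => G.2 v (le_of_eq hv),
    fun q => ⟨Γ q, hS q⟩, fun G => ?_, fun q => ?_⟩, ?_, hΓ.subtype_mk _⟩⟩
  · refine Subtype.ext (Subtype.ext (ContinuousMap.ext fun v => ?_))
    by_cases hv : v.1.proj ∈ HS
    · exact (hS _ v hv).trans (G.2 v hv).symm
    · have hv' : v.1.proj ∈ HN := (not_le.1 (show ¬ (v.1.proj : E3) 2 ≤ 0 from hv)).le
      exact hN _ ⟨v.1, hv'⟩
  · exact Subtype.ext (ContinuousMap.ext fun v => hN q v)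
  · exact ((ContinuousMap.continuous_precomp _).comp
      (continuous_subtype_val.comp continuous_subtype_val)).subtype_mk _

end Fibre

/-- **Smale's fibration theorem (first half).**  Let `p` be a base point on the equator.
The restriction map `Imm_p(S², ℝ³) → Imm_p(H_S, ℝ³)` is a Serre fibration, and its fibre
over `f₀|_{H_S}` — the immersions of `S²` pointed at `p` which coincide with the standard
embedding on the southern hemisphere — is homeomorphic to `Imm_E(H_N, ℝ³)`, the space of
immersions of `H_N` whose 1-jet agrees with that of `f₀` along the equator. -/
theorem restriction_to_southern_hemisphere_is_serre_fibration
    (p : S2) (hp : p ∈ EqS) :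
    ∃ ρ : ImmGerm Set.univ {p} → ImmGerm HS {p},
      (∀ (G : ImmGerm Set.univ {p}) (v : {v : TB // v.proj ∈ HS}),
        (ρ G).1 v = G.1 ⟨v.1, Set.mem_univ _⟩) ∧
      IsSerreFibration ρ ∧
      Nonempty
        (({G : ImmGerm Set.univ {p} //
            ∀ v : {v : TB // v.proj ∈ Set.univ}, v.1.proj ∈ HS → G.1 v = tm stdEmb v.1}) ≃ₜ
          ImmGerm HN EqS) :=
  have hρ : ∀ (G : ImmGerm Set.univ {p}) (v : {v : TB // v.proj ∈ HS}),
      (restrictImm HS {p} G fun v hv => immGerm_eq_stdEmb G v hv).1 v =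
        G.1 ⟨v.1, Set.mem_univ _⟩ := fun _ _ => rfl
  ⟨_, hρ, isSerreFibration_restriction hp _ hρ, nonempty_fibre_homeomorph hp⟩

end
end
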